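/- Let φ: F → G be a graded morphism between free graded R-modules of ranks t = 3 and t+c−1 = 5 (so t = 3 and c = 3), φ*: G* → F* its dual, M = coker(φ*), ℓ := Σ_{j=1}^{5} a_j − Σ_{i=1}^{3} b_i, B₂ := R/I₂(φ), and assume depth_{I₂(φ)} R = 8. Then S₂(∧²M) ≅ K_{B₂}(n+1−2ℓ), where K_{B₂} = Ext_R^{8}(B₂, R)(−n−1) is the canonical module of B₂. -/

import Mathlib

/-!
Common setup for formalizing "Schur powers of the cokernel of a graded morphism"
by J.O. Kleppe and R.M. Miró-Roig.
-/

open Matrix TensorProduct CategoryTheory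

noncomputable section

namespace KMR

/-- The standard graded polynomial ring `R = k[x₀,…,xₙ]`. -/
abbrev RR (k : Type) [Field k] (n : ℕ) : Type := MvPolynomial (Fin (n + 1)) k

variable {k : Type} [Field k] {n : ℕ}

/-- The irrelevant maximal ideal `𝔪 = (x₀,…,xₙ)`. -/
def mxI (k : Type) [Field k] (n : ℕ) : Ideal (RR k n) :=
  Ideal.span (Set.range MvPolynomial.X)

/-- The ideal `I_j(A)` generated by the `j × j` minors of the matrix `A`. -/
def minors {g t : ℕ} (A : Matrix (Fin g) (Fin t) (RR k n)) (j : ℕ) : Ideal (RR k n) :=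
  Ideal.span {m | ∃ (r : Fin j → Fin g) (c : Fin j → Fin t),
    Function.Injective r ∧ Function.Injective c ∧ m = (A.submatrix r c).det}

/-- The matrix `A` represents a graded morphism `φ : F = ⊕ R(bⱼ) → G = ⊕ R(aᵢ)`,
i.e. each entry `A i j` is homogeneous of degree `aᵢ - bⱼ` (or zero). -/
def IsHomogMatrix {g t : ℕ} (A : Matrix (Fin g) (Fin t) (RR k n))
    (a : Fin g → ℤ) (b : Fin t → ℤ) : Prop :=
  ∀ i j, A i j = 0 ∨ ∃ d : ℕ, (d : ℤ) = a i - b j ∧ (A i j).IsHomogeneous d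

/-- The morphism `φ` is minimal, i.e. `φ(F) ⊆ 𝔪 G`:
all entries of a representing matrix have vanishing constant term. -/
def IsMinMatrix {g t : ℕ} (A : Matrix (Fin g) (Fin t) (RR k n)) : Prop :=
  ∀ i j, MvPolynomial.constantCoeff (A i j) = 0

/-- `depthGE J N d` : there is an `N`-regular sequence of length `d` inside `J`,
i.e. `depth_J N ≥ d`. -/
def depthGE {R : Type} [CommRing R] (J : Ideal R) (N : Type) [AddCommGroup N] [Module R N]
    (d : ℕ) : Prop :=
  ∃ rs : List R, rs.length = d ∧ (∀ x ∈ rs, x ∈ J) ∧ RingTheory.Sequence.IsRegular N rs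

/-- `depthEQ J N d` : the length of a maximal `N`-regular sequence in `J` is exactly `d`. -/
def depthEQ {R : Type} [CommRing R] (J : Ideal R) (N : Type) [AddCommGroup N] [Module R N]
    (d : ℕ) : Prop :=
  depthGE J N d ∧ ¬ depthGE J N (d + 1)

/-- The morphism `φ : F → G` of free modules represented by the matrix `A`. -/
def phi {g t : ℕ} (A : Matrix (Fin g) (Fin t) (RR k n)) :
    (Fin t → RR k n) →ₗ[RR k n] (Fin g → RR k n) := A.mulVecLin

/-- The dual morphism `φ* : G* → F*`, represented by the transposed matrix. -/
def phiStar {g t : ℕ} (A : Matrix (Fin g) (Fin t) (RR k n)) :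
    (Fin g → RR k n) →ₗ[RR k n] (Fin t → RR k n) := A.transpose.mulVecLin

/-- `M = coker (φ*)`. -/
abbrev Mdl {g t : ℕ} (A : Matrix (Fin g) (Fin t) (RR k n)) : Type :=
  (Fin t → RR k n) ⧸ LinearMap.range (phiStar A)

/-- The canonical projection `F* → M = coker φ*`. -/
def MdlProj {g t : ℕ} (A : Matrix (Fin g) (Fin t) (RR k n)) :
    (Fin t → RR k n) →ₗ[RR k n] Mdl A :=
  Submodule.mkQ _

/-- The `i`-th symmetric power of a module, as a quotient of the `i`-th tensor power. -/
abbrev SymPow (R : Type) [CommRing R] (M : Type) [AddCommGroup M] [Module R M] (i : ℕ) : Type :=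
  (⨂[R]^i M) ⧸ Submodule.span R
    {z | ∃ (σ : Equiv.Perm (Fin i)) (f : Fin i → M),
      z = PiTensorProduct.tprod R f - PiTensorProduct.tprod R (f ∘ σ)}

section ExtPow

variable {R M N : Type} [CommRing R] [AddCommGroup M] [Module R M]
  [AddCommGroup N] [Module R N]

lemma extPow_map_mem (p : ℕ) (f : M →ₗ[R] N) {x : ExteriorAlgebra R M}
    (hx : x ∈ ⋀[R]^p M) : ExteriorAlgebra.map f x ∈ ⋀[R]^p N := by
  rw [← ExteriorAlgebra.ιMulti_span_fixedDegree] at hx ⊢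
  induction hx using Submodule.span_induction with
  | mem x h =>
      obtain ⟨v, rfl⟩ := h
      rw [ExteriorAlgebra.map_apply_ιMulti]
      exact Submodule.subset_span ⟨_, rfl⟩
  | zero => simpa using Submodule.zero_mem _
  | add x y _ _ h1 h2 => simpa using Submodule.add_mem _ h1 h2
  | smul r x _ h => simpa using Submodule.smul_mem _ r h

/-- The induced map `⋀^p M → ⋀^p N` of a linear map `f : M → N`. -/
def extPowMap (p : ℕ) (f : M →ₗ[R] N) : (⋀[R]^p M) →ₗ[R] (⋀[R]^p N) :=
  (ExteriorAlgebra.map f).toLinearMap.restrict (fun _ hx => extPow_map_mem p f hx)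

end ExtPow

section Wedge

variable (R L : Type) [CommRing R] [AddCommGroup L] [Module R L]

/-- Auxiliary map `L ⊗ L → Λ(L)`, `x ⊗ y ↦ ι x * ι y`. -/
def wedgeToAlg : L ⊗[R] L →ₗ[R] ExteriorAlgebra R L :=
  (LinearMap.mul' R (ExteriorAlgebra R L)).comp
    (TensorProduct.map (ExteriorAlgebra.ι R) (ExteriorAlgebra.ι R))

lemma wedgeToAlg_mem (z : L ⊗[R] L) : wedgeToAlg R L z ∈ ⋀[R]^2 L := by
  induction z using TensorProduct.induction_on with
  | zero => simpa using Submodule.zero_mem _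
  | tmul x y =>
      have : wedgeToAlg R L (x ⊗ₜ[R] y) =
          ExteriorAlgebra.ι R x * ExteriorAlgebra.ι R y := by
        simp [wedgeToAlg]
      have h2 : (⋀[R]^2 L) =
          LinearMap.range (ExteriorAlgebra.ι R (M := L)) *
            LinearMap.range (ExteriorAlgebra.ι R (M := L)) := pow_two _
      rw [this, h2]
      exact Submodule.mul_mem_mul (LinearMap.mem_range_self _ x) (LinearMap.mem_range_self _ y)
  | add x y h1 h2 => simpa using Submodule.add_mem _ h1 h2

/-- The wedge product map `L ⊗ L → ⋀² L`, `x ⊗ y ↦ x ∧ y`. -/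
def wedge2 : L ⊗[R] L →ₗ[R] (⋀[R]^2 L) :=
  (wedgeToAlg R L).codRestrict _ (wedgeToAlg_mem R L)

end Wedge

section ExtTor

variable (R : Type) [CommRing R]

/-- `Ext^i_R(M, N)` as an object of `ModuleCat R` (via the derived functor `Ext`). -/
abbrev ExtM (i : ℕ) (M N : Type) [AddCommGroup M] [Module R M] [AddCommGroup N] [Module R N] :
    ModuleCat R :=
  ((Ext R (ModuleCat R) i).obj (Opposite.op (ModuleCat.of R M))).obj (ModuleCat.of R N)

/-- `Tor_i^R(M, N)` as an object of `ModuleCat R` (via the derived functor `Tor`). -/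
abbrev TorM (i : ℕ) (M N : Type) [AddCommGroup M] [Module R M] [AddCommGroup N] [Module R N] :
    ModuleCat R :=
  ((Tor (ModuleCat R) i).obj (ModuleCat.of R M)).obj (ModuleCat.of R N)

/-- Isomorphism of `R`-modules, stated for objects of `ModuleCat R`. -/
def misoM {R : Type} [CommRing R] (X Y : ModuleCat R) : Prop := Nonempty (X ≅ Y)

end ExtTor

section Schur

/-- The cells of the Young diagram whose `r`-th row has length `lens r`. -/
abbrev YoungCells (m : ℕ) (lens : Fin m → ℕ) : Type := Σ r : Fin m, Fin (lens r)

variable (R M : Type) [CommRing R] [AddCommGroup M] [Module R M]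

/-- The action of a permutation of the index set on a tensor power. -/
def permAct {ι : Type} [Fintype ι] (σ : Equiv.Perm ι) :
    (⨂[R] _ : ι, M) →ₗ[R] (⨂[R] _ : ι, M) :=
  (PiTensorProduct.reindex R (fun _ : ι => M) σ).toLinearMap

open scoped Classical in
/-- The Young symmetrizer attached to the Young diagram with row lengths `lens`:
`e = Σ_{σ ∈ RowStab} Σ_{τ ∈ ColStab} sgn(τ) • (σ τ)` acting on the tensor power of `M`
indexed by the cells of the diagram.  (We work in characteristic zero, where its image
is the Schur power `Σ^I M` for the partition `I` with conjugate row lengths `lens`.) -/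
def youngSymmetrizer (m : ℕ) (lens : Fin m → ℕ) :
    (⨂[R] _ : YoungCells m lens, M) →ₗ[R] (⨂[R] _ : YoungCells m lens, M) :=
  ∑ σ : Equiv.Perm (YoungCells m lens), ∑ τ : Equiv.Perm (YoungCells m lens),
    if (∀ x, (σ x).1 = x.1) ∧ (∀ x, ((τ x).2 : ℕ) = ((x.2 : ℕ))) then
      ((Equiv.Perm.sign τ : ℤ) • permAct R M (σ * τ))
    else 0

/-- The Schur power `Σ^I M` of `M`, for the partition `I` whose Young diagram has
row lengths `lens` (read as a Young diagram; rows of the diagram of `I`). -/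
abbrev SchurPow (m : ℕ) (lens : Fin m → ℕ) : Type :=
  ↥(LinearMap.range (youngSymmetrizer R M m lens))

end Schur

section SymZ

variable {g t : ℕ} (A : Matrix (Fin g) (Fin t) (RR k n))

/-- Auxiliary: `SZ A 0 = Hom_R(M, R/I_t(A)) = S_{-1}M` and `SZ A (m+1) = S_m M`. -/
def SZ : ℕ → Type
  | 0 => Mdl A →ₗ[RR k n] (RR k n ⧸ minors A t)
  | (m + 1) => SymPow (RR k n) (Mdl A) m

instance : ∀ m, AddCommGroup (SZ A m)
  | 0 => inferInstanceAs (AddCommGroup (Mdl A →ₗ[RR k n] (RR k n ⧸ minors A t)))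
  | (m + 1) => inferInstanceAs (AddCommGroup (SymPow (RR k n) (Mdl A) m))

instance : ∀ m, Module (RR k n) (SZ A m)
  | 0 => inferInstanceAs (Module (RR k n) (Mdl A →ₗ[RR k n] (RR k n ⧸ minors A t)))
  | (m + 1) => inferInstanceAs (Module (RR k n) (SymPow (RR k n) (Mdl A) m))

/-- `S_i M` for `i ∈ ℤ`, `i ≥ -1`:  `SymZ A (-1) = Hom(M, B_t)` and `SymZ A i = S_i M`
for `i ≥ 0` (junk value `Hom(M, B_t)` for `i < -1`). -/
abbrev SymZ (i : ℤ) : Type := SZ A (i + 1).toNat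

end SymZ

section IdealTransform

variable {R : Type} [CommRing R] (J : Ideal R)
variable (N : Type) [AddCommGroup N] [Module R N]

/-- `Hom_R(Jᵛ, N)`. -/
abbrev homPow (ν : ℕ) : Type := ↥(J ^ ν) →ₗ[R] N

/-- Restriction `Hom(Jᵛ, N) → Hom(Jᵘ, N)` along `Jᵘ ⊆ Jᵛ` for `ν ≤ μ`. -/
def homPowMap (ν μ : ℕ) (h : ν ≤ μ) : homPow J N ν →ₗ[R] homPow J N μ :=
  LinearMap.lcomp R N (Submodule.inclusion (Ideal.pow_le_pow_right h))

/-- The ideal transform `D_J(N) = colim_ν Hom_R(Jᵛ, N)`.  By Deligne's formula this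
computes `H⁰_*(U, Ñ)` for `U` the complement of `V(J)`. -/
abbrev IdealTransform : Type := Module.DirectLimit (homPow J N) (homPowMap J N)

end IdealTransform

/-- A homogeneous ideal of `R = k[x₀,…,xₙ]`. -/
def IsHomogIdeal (I : Ideal (RR k n)) : Prop :=
  ∀ f ∈ I, ∀ d : ℕ, MvPolynomial.homogeneousComponent d f ∈ I

/-- The identity element of `V ⊗ V*` for the free module `V = R^m` (both `V` and its
dual realized as `Fin m → R`). -/
def idElem (R : Type) [CommRing R] (m : ℕ) : (Fin m → R) ⊗[R] (Fin m → R) :=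
  ∑ i : Fin m, (Pi.single i 1) ⊗ₜ[R] (Pi.single i 1)

end KMR

namespace KMR

/-! ### Strands of an iterated Hilbert–Burch extension -/

section Strand

variable {R : Type} [CommRing R]

/-- A bigraded complex with an action of three commuting operators `y` (and right inverses `σ`),
together with an evaluation `τ` and a pairing `Ψ` with polynomials in three variables. -/
structure StrandData (R V : Type) [CommRing R] [AddCommGroup V] [Module R V] where
  D : V →ₗ[R] V
  y : Fin 3 → V →ₗ[R] V
  σ : Fin 3 → V →ₗ[R] V
  gr : ℤ → ℤ → Submodule R V
  τ : V →ₗ[R] R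
  Ψ : MvPolynomial (Fin 3) R →ₗ[R] V →ₗ[R] R

variable {V : Type} [AddCommGroup V] [Module R V]

/-- The operator `(a × y)_p`. -/
def crossOp (a : Fin 3 → R) (y : Fin 3 → V →ₗ[R] V) (p : Fin 3) : V →ₗ[R] V :=
  a (p + 1) • y (p + 2) - a (p + 2) • y (p + 1)

lemma crossOp_apply (a : Fin 3 → R) (y : Fin 3 → V →ₗ[R] V) (p : Fin 3) (v : V) :
    crossOp a y p v = a (p + 1) • y (p + 2) v - a (p + 2) • y (p + 1) v := rfl

/-- The axioms satisfied by the strands, with `t` the top homological degree. -/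
structure StrandData.Good (X : StrandData R V) (t : ℤ) : Prop where
  D_D : ∀ v, X.D (X.D v) = 0
  D_y : ∀ q v, X.D (X.y q v) = X.y q (X.D v)
  y_comm : ∀ q r v, X.y q (X.y r v) = X.y r (X.y q v)
  y_σ_self : ∀ q v, X.y q (X.σ q v) = v
  y_σ : ∀ q r, q ≠ r → ∀ v, X.y q (X.σ r v) = X.σ r (X.y q v)
  gr_D : ∀ {i δ v}, v ∈ X.gr i δ → X.D v ∈ X.gr (i - 1) δ
  gr_y : ∀ {i δ v} q, v ∈ X.gr i δ → X.y q v ∈ X.gr i (δ + 1)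
  gr_σ : ∀ {i δ v} q, v ∈ X.gr i δ → X.σ q v ∈ X.gr i (δ - 1)
  gr_neg : ∀ {i δ v}, i < 0 → v ∈ X.gr i δ → v = 0
  gr_top : ∀ {i δ v}, t < i → v ∈ X.gr i δ → v = 0
  gr_lt : ∀ {i δ v}, i < δ → v ∈ X.gr i δ → v = 0
  ker : ∀ {i δ v}, v ∈ X.gr i δ → δ ≤ 0 → (∀ q, X.y q v = 0) →
    (δ < 0 ∨ i ≠ 0 ∨ X.τ v = 0) → v = 0
  one : ∃ u ∈ X.gr 0 0, X.τ u = 1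
  dualBasis : ∀ i δ, ∃ (ι : Type) (_ : Fintype ι) (f : ι → V →ₗ[R] R) (e : ι → V),
    (∀ j, e j ∈ X.gr i δ) ∧ ∀ v ∈ X.gr i δ, v = ∑ j, f j v • e j
  Ψ_X_mul : ∀ p P v, X.Ψ (MvPolynomial.X p * P) v = X.Ψ P (X.y p v)

/-- The underlying module of the extension by one row. -/
abbrev StepV (V : Type) : Type := V × (Fin 3 → V) × V × V

/-- Extension of a strand complex by one row `a`. -/
def StrandData.step (X : StrandData R V) (a : Fin 3 → R) : StrandData R (StepV V) where
  D :=
    { toFun := fun v => (X.D v.1 + ∑ p, crossOp a X.y p (v.2.1 p),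
        fun p => - X.D (v.2.1 p) + a p • v.2.2.1 + X.y p v.2.2.2, X.D v.2.2.1, X.D v.2.2.2)
      map_add' := fun v w => by
        ext <;> simp [Fin.sum_univ_three] <;> abel
      map_smul' := fun r v => by
        ext
        · simp [Finset.smul_sum]
        · simp [smul_comm r]
        · simp
        · simp }
  y := fun q => (X.y q).prodMap ((LinearMap.pi fun p => X.y q ∘ₗ LinearMap.proj p).prodMap
    ((X.y q).prodMap (X.y q)))
  σ := fun q => (X.σ q).prodMap ((LinearMap.pi fun p => X.σ q ∘ₗ LinearMap.proj p).prodMap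
    ((X.σ q).prodMap (X.σ q)))
  gr := fun i δ => (X.gr i δ).prod ((Submodule.pi Set.univ fun _ => X.gr (i - 1) (δ - 1)).prod
    ((X.gr (i - 2) (δ - 1)).prod (X.gr (i - 2) (δ - 2))))
  τ := X.τ ∘ₗ LinearMap.fst R _ _
  Ψ := (LinearMap.lcomp R R
    (LinearMap.fst R V V ∘ₗ LinearMap.snd R _ _ ∘ₗ LinearMap.snd R V _)) ∘ₗ X.Ψ

namespace StrandData

variable (X : StrandData R V) (a : Fin 3 → R)

@[simp] lemma step_D (v : StepV V) : (X.step a).D v =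
    (X.D v.1 + ∑ p, crossOp a X.y p (v.2.1 p),
      fun p => - X.D (v.2.1 p) + a p • v.2.2.1 + X.y p v.2.2.2, X.D v.2.2.1, X.D v.2.2.2) := rfl

@[simp] lemma step_y (q : Fin 3) (v : StepV V) : (X.step a).y q v =
    (X.y q v.1, fun p => X.y q (v.2.1 p), X.y q v.2.2.1, X.y q v.2.2.2) := rfl

@[simp] lemma step_σ (q : Fin 3) (v : StepV V) : (X.step a).σ q v =
    (X.σ q v.1, fun p => X.σ q (v.2.1 p), X.σ q v.2.2.1, X.σ q v.2.2.2) := rfl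

@[simp] lemma step_τ (v : StepV V) : (X.step a).τ v = X.τ v.1 := rfl

@[simp] lemma step_Ψ (P : MvPolynomial (Fin 3) R) (v : StepV V) :
    (X.step a).Ψ P v = X.Ψ P v.2.2.1 := rfl

lemma mem_step_gr {i δ : ℤ} {v : StepV V} : v ∈ (X.step a).gr i δ ↔
    v.1 ∈ X.gr i δ ∧ (∀ p, v.2.1 p ∈ X.gr (i - 1) (δ - 1)) ∧ v.2.2.1 ∈ X.gr (i - 2) (δ - 1) ∧
      v.2.2.2 ∈ X.gr (i - 2) (δ - 2) := by
  simp [step, Submodule.mem_prod]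

variable {X} {a} {t : ℤ}

lemma Good.gr_cross (hX : X.Good t) {i δ : ℤ} {v : V} (p : Fin 3) (hv : v ∈ X.gr i δ) :
    crossOp a X.y p v ∈ X.gr i (δ + 1) :=
  Submodule.sub_mem _ (Submodule.smul_mem _ _ (hX.gr_y _ hv)) (Submodule.smul_mem _ _ (hX.gr_y _ hv))

lemma stepV_eq_zero {v : StepV V} (h1 : v.1 = 0) (h2 : ∀ p, v.2.1 p = 0) (h3 : v.2.2.1 = 0)
    (h4 : v.2.2.2 = 0) : v = 0 := by
  ext
  · simpa using h1
  · simpa using h2 _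
  · simpa using h3
  · simpa using h4

theorem Good.step (hX : X.Good t) (a : Fin 3 → R) : (X.step a).Good (t + 2) where
  D_D v := by
    ext
    · simp [Fin.sum_univ_three, crossOp_apply, hX.D_D, hX.D_y, smul_add,
        hX.y_comm 1 0, hX.y_comm 2 0, hX.y_comm 2 1]
      module
    · simp [hX.D_D, hX.D_y]
    · simp [hX.D_D]
    · simp [hX.D_D]
  D_y q v := by
    ext
    · simp [crossOp_apply, hX.D_y, map_sum, hX.y_comm q]
    · simp [hX.D_y, hX.y_comm q]
    · simp [hX.D_y]
    · simp [hX.D_y]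
  y_comm q r v := by
    ext <;> simp [hX.y_comm q r]
  y_σ_self q v := by
    ext <;> simp [hX.y_σ_self q]
  y_σ q r h v := by
    ext <;> simp [hX.y_σ q r h]
  gr_D {i δ v} hv := by
    rw [mem_step_gr] at hv ⊢
    obtain ⟨h1, h2, h3, h4⟩ := hv
    simp only [step_D]
    refine ⟨Submodule.add_mem _ (hX.gr_D h1) (Submodule.sum_mem _ fun p _ => ?_), fun p => ?_,
      ?_, ?_⟩
    · simpa using hX.gr_cross p (h2 p)
    · refine Submodule.add_mem _ (Submodule.add_mem _ (Submodule.neg_mem _ (hX.gr_D (h2 p)))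
        (Submodule.smul_mem _ _ ?_)) ?_
      · convert h3 using 2; ring
      · convert hX.gr_y p h4 using 2 <;> ring
    · convert hX.gr_D h3 using 2; ring
    · convert hX.gr_D h4 using 2; ring
  gr_y {i δ v} q hv := by
    rw [mem_step_gr] at hv ⊢
    obtain ⟨h1, h2, h3, h4⟩ := hv
    simp only [step_y]
    refine ⟨hX.gr_y q h1, fun p => ?_, ?_, ?_⟩
    · convert hX.gr_y q (h2 p) using 2; ring
    · convert hX.gr_y q h3 using 2; ring
    · convert hX.gr_y q h4 using 2; ring
  gr_σ {i δ v} q hv := by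
    rw [mem_step_gr] at hv ⊢
    obtain ⟨h1, h2, h3, h4⟩ := hv
    simp only [step_σ]
    refine ⟨hX.gr_σ q h1, fun p => ?_, ?_, ?_⟩
    · exact hX.gr_σ q (h2 p)
    · exact hX.gr_σ q h3
    · convert hX.gr_σ q h4 using 2; ring
  gr_neg {i δ v} hi hv := by
    rw [mem_step_gr] at hv
    obtain ⟨h1, h2, h3, h4⟩ := hv
    exact stepV_eq_zero (hX.gr_neg hi h1) (fun p => hX.gr_neg (by omega) (h2 p))
      (hX.gr_neg (by omega) h3) (hX.gr_neg (by omega) h4)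
  gr_top {i δ v} hi hv := by
    rw [mem_step_gr] at hv
    obtain ⟨h1, h2, h3, h4⟩ := hv
    exact stepV_eq_zero (hX.gr_top (by omega) h1) (fun p => hX.gr_top (by omega) (h2 p))
      (hX.gr_top (by omega) h3) (hX.gr_top (by omega) h4)
  gr_lt {i δ v} hi hv := by
    rw [mem_step_gr] at hv
    obtain ⟨h1, h2, h3, h4⟩ := hv
    exact stepV_eq_zero (hX.gr_lt (by omega) h1) (fun p => hX.gr_lt (by omega) (h2 p))
      (hX.gr_lt (by omega) h3) (hX.gr_lt (by omega) h4)
  ker {i δ v} hv hδ hy hc := by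
    rw [mem_step_gr] at hv
    obtain ⟨h1, h2, h3, h4⟩ := hv
    simp only [step_y, Prod.mk_eq_zero, funext_iff, Pi.zero_apply] at hy
    exact stepV_eq_zero (hX.ker h1 hδ (fun q => (hy q).1) hc)
      (fun p => hX.ker (h2 p) (by omega) (fun q => (hy q).2.1 p) (Or.inl (by omega)))
      (hX.ker h3 (by omega) (fun q => (hy q).2.2.1) (Or.inl (by omega)))
      (hX.ker h4 (by omega) (fun q => (hy q).2.2.2) (Or.inl (by omega)))
  one := by
    obtain ⟨u, hu, h⟩ := hX.one
    exact ⟨(u, 0, 0, 0), by simp [mem_step_gr, hu], h⟩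
  dualBasis i δ := by
    obtain ⟨ι₁, _, f₁, e₁, he₁, h₁⟩ := hX.dualBasis i δ
    obtain ⟨ι₂, _, f₂, e₂, he₂, h₂⟩ := hX.dualBasis (i - 1) (δ - 1)
    obtain ⟨ι₃, _, f₃, e₃, he₃, h₃⟩ := hX.dualBasis (i - 2) (δ - 1)
    obtain ⟨ι₄, _, f₄, e₄, he₄, h₄⟩ := hX.dualBasis (i - 2) (δ - 2)
    refine ⟨ι₁ ⊕ (Fin 3 × ι₂) ⊕ ι₃ ⊕ ι₄, inferInstance,
      Sum.elim (fun j => f₁ j ∘ₗ LinearMap.fst R _ _) <|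
        Sum.elim (fun j => f₂ j.2 ∘ₗ LinearMap.proj j.1 ∘ₗ LinearMap.fst R _ _ ∘ₗ
          LinearMap.snd R _ _) <|
        Sum.elim (fun j => f₃ j ∘ₗ LinearMap.fst R _ _ ∘ₗ LinearMap.snd R _ _ ∘ₗ
          LinearMap.snd R _ _)
        (fun j => f₄ j ∘ₗ LinearMap.snd R _ _ ∘ₗ LinearMap.snd R _ _ ∘ₗ LinearMap.snd R _ _),
      Sum.elim (fun j => (e₁ j, 0, 0, 0)) <| Sum.elim (fun j => (0, Pi.single j.1 (e₂ j.2), 0, 0)) <|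
        Sum.elim (fun j => (0, 0, e₃ j, 0)) (fun j => (0, 0, 0, e₄ j)), ?_, ?_⟩
    · rintro (j | j | j | j) <;> simp [mem_step_gr, he₁, he₃, he₄]
      intro p
      by_cases hp : p = j.1
      · subst hp; simpa using he₂ _
      · simp [hp]
    · intro v hv
      rw [mem_step_gr] at hv
      obtain ⟨k1, k2, k3, k4⟩ := hv
      ext p
      · simpa [Prod.fst_sum, Prod.snd_sum] using h₁ _ k1
      · simpa [Prod.fst_sum, Prod.snd_sum, Fintype.sum_prod_type, Pi.single_apply,
          Finset.sum_comm (γ := ι₂), ← apply_ite, smul_ite] using h₂ _ (k2 p)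
      · simpa [Prod.fst_sum, Prod.snd_sum] using h₃ _ k3
      · simpa [Prod.fst_sum, Prod.snd_sum] using h₄ _ k4
  Ψ_X_mul p P v := by simp [hX.Ψ_X_mul]

end StrandData
end Strand

section Base

variable {R : Type} [CommRing R]

/-- The base strand complex: the module of functions on monomials, in homological degree `0`. -/
def StrandData.base (R : Type) [CommRing R] : StrandData R ((Fin 3 →₀ ℕ) → R) where
  D := 0
  y q := LinearMap.funLeft R R fun α => α + Finsupp.single q 1
  σ q :=
    { toFun := fun f α => if α q = 0 then 0 else f (α - Finsupp.single q 1)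
      map_add' := fun f g => by ext α; by_cases h : α q = 0 <;> simp [h]
      map_smul' := fun r f => by ext α; by_cases h : α q = 0 <;> simp [h] }
  gr i δ :=
    { carrier := {f | ∀ α, f α ≠ 0 → i = 0 ∧ (α.degree : ℤ) = -δ}
      add_mem' := fun {f g} hf hg α h => by
        by_contra hc
        exact h (by simp [not_ne_iff.1 (mt (hf α) hc), not_ne_iff.1 (mt (hg α) hc)])
      zero_mem' := fun α h => absurd rfl h
      smul_mem' := fun r f hf α h => hf α fun h0 => h (by simp [h0]) }
  τ := LinearMap.proj 0
  Ψ := MvPolynomial.basisMonomials (Fin 3) R |>.constr R fun α => LinearMap.proj α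

namespace StrandData

lemma base_y (q : Fin 3) (f : (Fin 3 →₀ ℕ) → R) (α : Fin 3 →₀ ℕ) :
    (base R).y q f α = f (α + Finsupp.single q 1) := rfl

lemma base_σ (q : Fin 3) (f : (Fin 3 →₀ ℕ) → R) (α : Fin 3 →₀ ℕ) :
    (base R).σ q f α = if α q = 0 then 0 else f (α - Finsupp.single q 1) := rfl

lemma base_D (f : (Fin 3 →₀ ℕ) → R) : (base R).D f = 0 := rfl

lemma base_τ (f : (Fin 3 →₀ ℕ) → R) : (base R).τ f = f 0 := rfl

lemma base_Ψ_monomial (α : Fin 3 →₀ ℕ) (r : R) (f : (Fin 3 →₀ ℕ) → R) :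
    (base R).Ψ (MvPolynomial.monomial α r) f = r * f α := by
  have h := (MvPolynomial.basisMonomials (Fin 3) R).constr_basis R
    (fun α => (LinearMap.proj α : ((Fin 3 →₀ ℕ) → R) →ₗ[R] R)) α
  have h2 : MvPolynomial.monomial α r = r • MvPolynomial.basisMonomials (Fin 3) R α := by
    simp [MvPolynomial.smul_monomial]
  rw [h2, map_smul]
  simp only [base, h]
  simp

lemma base_eq_zero {i δ : ℤ} {f : (Fin 3 →₀ ℕ) → R} (hf : f ∈ (base R).gr i δ)
    (h : ∀ α : Fin 3 →₀ ℕ, i = 0 → (α.degree : ℤ) = -δ → f α = 0) : f = 0 := by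
  ext α
  by_contra hc
  exact hc (h α (hf α hc).1 (hf α hc).2)

lemma finite_degree (d : ℤ) : Finite {α : Fin 3 →₀ ℕ // (α.degree : ℤ) = d} := by
  have : {α : Fin 3 →₀ ℕ | (α.degree : ℤ) = d} ⊆ {α | α.degree ≤ d.toNat} := fun α h => by
    simp only [Set.mem_ofPred_eq] at h ⊢; omega
  exact (Finsupp.finite_of_degree_le d.toNat).subset this

theorem base_good : (base R).Good 0 where
  D_D v := rfl
  D_y q v := by simp [base_D]
  y_comm q r v := by
    ext α
    simp only [base_y]
    congr 1
    abel
  y_σ_self q v := by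
    ext α
    simp [base_y, base_σ]
  y_σ q r h v := by
    ext α
    simp only [base_y, base_σ, Finsupp.add_apply, Finsupp.single_eq_of_ne h.symm, add_zero]
    split_ifs with h0
    · rfl
    · congr 1
      ext s
      simp only [Finsupp.add_apply, Finsupp.tsub_apply, Finsupp.single_apply]
      split_ifs <;> subst_vars <;> omega
  gr_D _ := by simp [base_D]
  gr_y {i δ v} q hv α h := by
    have := hv _ h
    simp only [map_add, Finsupp.degree_single] at this
    push_cast at this
    omega
  gr_σ {i δ v} q hv α h := by
    rw [base_σ] at h
    split_ifs at h with h0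
    · exact absurd rfl h
    have := hv _ h
    have h2 : α = (α - Finsupp.single q 1) + Finsupp.single q 1 := by
      rw [tsub_add_cancel_of_le]
      simpa using Nat.one_le_iff_ne_zero.2 h0
    have h3 := congrArg Finsupp.degree h2
    simp only [map_add, Finsupp.degree_single] at h3
    omega
  gr_neg {i δ v} hi hv := base_eq_zero hv fun α h => by omega
  gr_top {i δ v} hi hv := base_eq_zero hv fun α h => by omega
  gr_lt {i δ v} hi hv := base_eq_zero hv fun α h h' => by omega
  ker {i δ v} hv hδ hy hc := by
    refine base_eq_zero hv fun α hi hα => ?_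
    by_cases h0 : α = 0
    · subst h0
      rcases hc with hc | hc | hc
      · simp at hα; omega
      · exact absurd hi hc
      · exact hc
    · obtain ⟨q, hq⟩ : ∃ q, α q ≠ 0 := by
        by_contra! hc
        exact h0 (Finsupp.ext hc)
      have := congrFun (hy q) (α - Finsupp.single q 1)
      rwa [base_y, tsub_add_cancel_of_le (by simpa using Nat.one_le_iff_ne_zero.2 hq)] at this
  one := ⟨Pi.single 0 1, fun α h => by
    by_cases h0 : α = 0
    · simp [h0]
    · simp [h0] at h, by simp [base_τ]⟩
  dualBasis i δ := by
    classical
    by_cases hi : i = 0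
    · have := finite_degree (-δ)
      let := Fintype.ofFinite {α : Fin 3 →₀ ℕ // (α.degree : ℤ) = -δ}
      refine ⟨{α : Fin 3 →₀ ℕ // (α.degree : ℤ) = -δ}, inferInstance,
        fun α => LinearMap.proj α.1, fun α => Pi.single α.1 1, fun α β h => ?_, fun v hv => ?_⟩
      · by_cases h0 : β = α.1
        · subst h0; exact ⟨hi, α.2⟩
        · simp [h0] at h
      · ext β
        simp only [LinearMap.proj_apply, Finset.sum_apply, Pi.smul_apply, Pi.single_apply,
          smul_eq_mul, mul_ite, mul_one, mul_zero]
        by_cases hβ : (β.degree : ℤ) = -δ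
        · rw [Finset.sum_eq_single ⟨β, hβ⟩]
          · simp
          · intro γ _ hγ
            rw [if_neg]
            rintro rfl
            exact hγ rfl
          · simp
        · rw [Finset.sum_eq_zero]
          · by_contra hc
            exact hβ (hv β hc).2
          · intro γ _
            rw [if_neg]
            rintro rfl
            exact hβ γ.2
    · refine ⟨Empty, inferInstance, Empty.elim, Empty.elim, fun j => j.elim, fun v hv => ?_⟩
      simpa using base_eq_zero hv fun α h => absurd h hi
  Ψ_X_mul p P f := by
    induction P using MvPolynomial.induction_on' with
    | monomial α r =>
      rw [MvPolynomial.X, MvPolynomial.monomial_mul, base_Ψ_monomial, base_Ψ_monomial, base_y,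
        one_mul, add_comm]
    | add P Q hP hQ => simp only [mul_add, map_add, LinearMap.add_apply, hP, hQ]

end StrandData
end Base

section Homotopy

variable {R : Type} [CommRing R] {V : Type} [AddCommGroup V] [Module R V]

namespace StrandData

/-- `T` is null-homotopic by a `y`-linear homotopy of bidegree `(1, 1)`. -/
def NullHtpy (X : StrandData R V) (T : V →ₗ[R] V) : Prop :=
  ∃ h : V →ₗ[R] V, (∀ v, X.D (h v) + h (X.D v) = T v) ∧ (∀ q v, h (X.y q v) = X.y q (h v)) ∧
    ∀ {i δ v}, v ∈ X.gr i δ → h v ∈ X.gr (i + 1) (δ + 1)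

variable {X : StrandData R V} {t : ℤ}

lemma NullHtpy.add {S T : V →ₗ[R] V} (hS : X.NullHtpy S) (hT : X.NullHtpy T) :
    X.NullHtpy (S + T) := by
  obtain ⟨h, h1, h2, h3⟩ := hS
  obtain ⟨k, k1, k2, k3⟩ := hT
  refine ⟨h + k, fun v => ?_, fun q v => by simp [h2, k2],
    fun hv => Submodule.add_mem _ (h3 hv) (k3 hv)⟩
  simp only [LinearMap.add_apply, map_add, ← h1, ← k1]
  abel

lemma NullHtpy.smul (r : R) {S : V →ₗ[R] V} (hS : X.NullHtpy S) : X.NullHtpy (r • S) := by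
  obtain ⟨h, h1, h2, h3⟩ := hS
  exact ⟨r • h, fun v => by simp [← h1], fun q v => by simp [h2],
    fun hv => Submodule.smul_mem _ _ (h3 hv)⟩

/-- Homotopies for a vector `b` extend along a step. -/
lemma NullHtpy.step_old {b : Fin 3 → R} {p : Fin 3} (h : X.NullHtpy (crossOp b X.y p))
    (a : Fin 3 → R) : (X.step a).NullHtpy (crossOp b (X.step a).y p) := by
  obtain ⟨h, h1, h2, h3⟩ := h
  refine ⟨h.prodMap ((LinearMap.pi fun p => - h ∘ₗ LinearMap.proj p).prodMap (h.prodMap h)),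
    fun v => ?_, fun q v => ?_, fun {i δ v} hv => ?_⟩
  · ext q
    · have := h1 v.1
      simp only [crossOp_apply] at this
      simp only [LinearMap.prodMap_apply, step_D, Prod.fst_add, LinearMap.pi_apply,
        LinearMap.comp_apply, LinearMap.neg_apply, LinearMap.proj_apply, crossOp_apply, step_y,
        Prod.fst_sub, Prod.smul_fst, map_neg, Fin.sum_univ_three, map_add, map_sub, map_smul, h2,
        ← this]
      module
    · have := h1 (v.2.1 q)
      simp only [crossOp_apply] at this
      simp only [LinearMap.prodMap_apply, step_D, Prod.fst_add, Prod.snd_add, LinearMap.pi_apply,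
        LinearMap.comp_apply, LinearMap.neg_apply, LinearMap.proj_apply, crossOp_apply, step_y,
        Prod.fst_sub, Prod.snd_sub, Prod.smul_fst, Prod.smul_snd, map_neg, map_add, map_smul, h2,
        Pi.add_apply, Pi.sub_apply, Pi.smul_apply, ← this]
      module
    · simp [crossOp_apply, h1]
    · simp [crossOp_apply, h1]
  · ext <;> simp [h2]
  · rw [mem_step_gr] at hv ⊢
    obtain ⟨k1, k2, k3, k4⟩ := hv
    refine ⟨h3 k1, fun p => Submodule.neg_mem _ ?_, ?_, ?_⟩
    · convert h3 (k2 p) using 2 <;> first | omega | rfl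
    · convert h3 k3 using 2 <;> first | omega | rfl
    · convert h3 k4 using 2 <;> first | omega | rfl

/-- The row added in a step acquires homotopies. -/
lemma Good.nullHtpy_step_new (hX : X.Good t) (a : Fin 3 → R) (p : Fin 3) :
    (X.step a).NullHtpy (crossOp a (X.step a).y p) := by
  refine ⟨LinearMap.prod 0 (LinearMap.prod (LinearMap.single R (fun _ => V) p ∘ₗ LinearMap.fst R _ _)
    (LinearMap.prod
      ((X.y (p + 2) ∘ₗ LinearMap.proj (p + 1) - X.y (p + 1) ∘ₗ LinearMap.proj (p + 2)) ∘ₗ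
        LinearMap.fst R _ _ ∘ₗ LinearMap.snd R _ _)
      ((a (p + 1) • LinearMap.proj (p + 2) - a (p + 2) • LinearMap.proj (p + 1)) ∘ₗ
        LinearMap.fst R _ _ ∘ₗ LinearMap.snd R _ _))),
    fun v => ?_, fun q v => ?_, fun {i δ v} hv => ?_⟩
  · ext q
    · fin_cases p <;> simp [Fin.sum_univ_three, crossOp_apply]
    · fin_cases p <;> fin_cases q <;>
        simp [Fin.sum_univ_three, crossOp_apply] <;> module
    · fin_cases p <;> simp [crossOp_apply, hX.D_y, hX.y_comm 1 0, hX.y_comm 2 0, hX.y_comm 2 1] <;>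
        module
    · fin_cases p <;> simp [crossOp_apply] <;> module
  · ext r
    · simp
    · by_cases h : r = p
      · subst h; simp
      · simp [h]
    · simp [hX.y_comm q]
    · simp
  · rw [mem_step_gr] at hv ⊢
    obtain ⟨k1, k2, k3, k4⟩ := hv
    refine ⟨Submodule.zero_mem _, fun r => ?_, Submodule.sub_mem _ ?_ ?_,
      Submodule.sub_mem _ (Submodule.smul_mem _ _ ?_) (Submodule.smul_mem _ _ ?_)⟩
    · by_cases h : r = p
      · subst h; simpa using k1
      · simp [h]
    · convert hX.gr_y (p + 2) (k2 (p + 1)) using 2 <;> first | omega | rfl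
    · convert hX.gr_y (p + 1) (k2 (p + 2)) using 2 <;> first | omega | rfl
    · convert k2 (p + 2) using 2 <;> first | omega | rfl
    · convert k2 (p + 1) using 2 <;> first | omega | rfl

/-- A `2 × 2` minor times any `y_m` is null-homotopic. -/
lemma nullHtpy_minor {a b : Fin 3 → R} (ha : ∀ p, X.NullHtpy (crossOp a X.y p))
    (hb : ∀ p, X.NullHtpy (crossOp b X.y p)) (p m : Fin 3) :
    X.NullHtpy ((a (p + 1) * b (p + 2) - a (p + 2) * b (p + 1)) • X.y m) := by
  have key : ∀ i j, X.NullHtpy (b i • X.y j - b j • X.y i) ∧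
      X.NullHtpy (a i • X.y j - a j • X.y i) := by
    have aux : ∀ c : Fin 3 → R, (∀ p, X.NullHtpy (crossOp c X.y p)) →
        ∀ i j, X.NullHtpy (c i • X.y j - c j • X.y i) := fun c hc i j => by
      have h0 := hc 0
      have h1 := hc 1
      have h2 := hc 2
      have n0 := h0.smul (-1)
      have n1 := h1.smul (-1)
      have n2 := h2.smul (-1)
      have hz := h0.smul 0
      simp only [crossOp, Fin.isValue, zero_add, neg_smul, one_smul, neg_sub, zero_smul,
        show (1 : Fin 3) + 1 = 2 from rfl, show (1 : Fin 3) + 2 = 0 from rfl,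
        show (2 : Fin 3) + 1 = 0 from rfl, show (2 : Fin 3) + 2 = 1 from rfl] at *
      fin_cases i <;> fin_cases j <;> simp only [Fin.reduceFinMk, Fin.zero_eta, Fin.mk_one,
        Fin.isValue, sub_self] <;> assumption
    exact fun i j => ⟨aux b hb i j, aux a ha i j⟩
  convert (((key (p + 2) m).1.smul (a (p + 1))).add (((key (p + 1) (p + 2)).2.smul (b m)))).add
    ((key m (p + 1)).1.smul (a (p + 2))) using 1
  ext v
  simp
  module

/-- The contraction of a cycle in strand `3` to the kernel of all `y`. -/
def E3 (X : StrandData R V) : V →ₗ[R] R :=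
  X.τ ∘ₗ X.D ∘ₗ X.σ 2 ∘ₗ X.D ∘ₗ X.σ 1 ∘ₗ X.D ∘ₗ X.σ 0

lemma E3_apply (v : V) : X.E3 v = X.τ (X.D (X.σ 2 (X.D (X.σ 1 (X.D (X.σ 0 v)))))) := rfl

/-- Cycles in strand `3` (in the kernel of the augmentation `E3` if in degree `3`) are torsion. -/
lemma Good.torsion (hX : X.Good t) {Δ : R} (hΔ : ∀ m, X.NullHtpy (Δ • X.y m)) {i : ℤ} {z : V}
    (hz : z ∈ X.gr i 3) (hD : X.D z = 0) (hi : i ≠ 3 ∨ X.E3 z = 0) :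
    ∃ w ∈ X.gr (i + 1) 3, X.D w = Δ ^ 3 • z := by
  obtain ⟨H0, a1, a2, a3⟩ := hΔ 0
  obtain ⟨H1, b1, b2, b3⟩ := hΔ 1
  obtain ⟨H2, c1, c2, c3⟩ := hΔ 2
  simp only [LinearMap.smul_apply] at a1 b1 c1
  obtain ⟨z1, e1⟩ : ∃ z1, z1 = X.D (X.σ 0 z) := ⟨_, rfl⟩
  obtain ⟨z2, e2⟩ : ∃ z2, z2 = X.D (X.σ 1 z1) := ⟨_, rfl⟩
  obtain ⟨z3, e3⟩ : ∃ z3, z3 = X.D (X.σ 2 z2) := ⟨_, rfl⟩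
  have g1 : z1 ∈ X.gr (i - 1) 2 := by
    rw [e1]; exact hX.gr_D (hX.gr_σ 0 hz)
  have g2 : z2 ∈ X.gr (i - 2) 1 := by
    rw [e2]; convert hX.gr_D (hX.gr_σ 1 g1) using 2 <;> omega
  have g3 : z3 ∈ X.gr (i - 3) 0 := by
    rw [e3]; convert hX.gr_D (hX.gr_σ 2 g2) using 2 <;> omega
  have d1 : X.D z1 = 0 := by rw [e1, hX.D_D]
  have d2 : X.D z2 = 0 := by rw [e2, hX.D_D]
  have y01 : X.y 0 z1 = 0 := by rw [e1, ← hX.D_y, hX.y_σ_self, hD]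
  have y12 : X.y 1 z2 = 0 := by rw [e2, ← hX.D_y, hX.y_σ_self, d1]
  have y02 : X.y 0 z2 = 0 := by
    rw [e2, ← hX.D_y, hX.y_σ 0 1 (by decide), y01]; simp
  have y23 : X.y 2 z3 = 0 := by rw [e3, ← hX.D_y, hX.y_σ_self, d2]
  have y03 : X.y 0 z3 = 0 := by
    rw [e3, ← hX.D_y, hX.y_σ 0 2 (by decide), y02]; simp
  have y13 : X.y 1 z3 = 0 := by
    rw [e3, ← hX.D_y, hX.y_σ 1 2 (by decide), y12]; simp
  have z30 : z3 = 0 := by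
    refine hX.ker g3 le_rfl (fun q => by fin_cases q <;> assumption) (Or.inr ?_)
    rcases hi with hi | hi
    · left; omega
    · right; rw [e3, e2, e1]; exact hi
  have f0 : Δ • z = X.D (H0 (X.σ 0 z)) + H0 z1 := by
    rw [e1, a1, hX.y_σ_self]
  have f1 : Δ • z1 = X.D (H1 (X.σ 1 z1)) + H1 z2 := by
    rw [e2, b1, hX.y_σ_self]
  have f2 : Δ • z2 = X.D (H2 (X.σ 2 z2)) := by
    have := c1 (X.σ 2 z2)
    rw [hX.y_σ_self, ← e3, z30, map_zero, add_zero] at this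
    exact this.symm
  have k0 : ∀ w, X.y 0 w = 0 → H0 (X.D w) = - X.D (H0 w) := fun w hw => by
    have := a1 w
    rw [hw, smul_zero] at this
    exact (neg_eq_of_add_eq_zero_right this).symm
  have k1 : ∀ w, X.y 1 w = 0 → H1 (X.D w) = - X.D (H1 w) := fun w hw => by
    have := b1 w
    rw [hw, smul_zero] at this
    exact (neg_eq_of_add_eq_zero_right this).symm
  have l1 : H0 (X.D (H1 (X.σ 1 z1))) = - X.D (H0 (H1 (X.σ 1 z1))) :=
    k0 _ (by rw [← b2, hX.y_σ 0 1 (by decide), y01]; simp)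
  have m0 : X.y 0 (H2 (X.σ 2 z2)) = 0 := by
    rw [← c2, hX.y_σ 0 2 (by decide), y02]; simp
  have m1 : X.y 1 (H2 (X.σ 2 z2)) = 0 := by
    rw [← c2, hX.y_σ 1 2 (by decide), y12]; simp
  have l2 : H0 (H1 (X.D (H2 (X.σ 2 z2)))) = X.D (H0 (H1 (H2 (X.σ 2 z2)))) := by
    rw [k1 _ m1, map_neg, k0 _ (by rw [← b2, m0, map_zero]), neg_neg]
  refine ⟨(Δ ^ 2) • H0 (X.σ 0 z) - Δ • H0 (H1 (X.σ 1 z1)) + H0 (H1 (H2 (X.σ 2 z2))),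
    Submodule.add_mem _ (Submodule.sub_mem _ (Submodule.smul_mem _ _ ?_)
      (Submodule.smul_mem _ _ ?_)) ?_, ?_⟩
  · exact a3 (hX.gr_σ 0 hz)
  · convert a3 (b3 (hX.gr_σ 1 g1)) using 2 <;> omega
  · convert a3 (b3 (c3 (hX.gr_σ 2 g2))) using 2 <;> omega
  · have s2 : Δ • H0 (H1 z2) = X.D (H0 (H1 (H2 (X.σ 2 z2)))) := by
      rw [← l2, ← f2, map_smul, map_smul]
    have s1 : Δ • H0 z1 = - X.D (H0 (H1 (X.σ 1 z1))) + H0 (H1 z2) := by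
      rw [← l1, ← map_smul, f1, map_add]
    calc X.D (Δ ^ 2 • H0 (X.σ 0 z) - Δ • H0 (H1 (X.σ 1 z1)) + H0 (H1 (H2 (X.σ 2 z2))))
        = Δ ^ 2 • X.D (H0 (X.σ 0 z)) + (Δ • (- X.D (H0 (H1 (X.σ 1 z1))) + H0 (H1 z2))) := by
          rw [map_add, map_sub, map_smul, map_smul, smul_add, s2]; module
      _ = Δ ^ 2 • (X.D (H0 (X.σ 0 z)) + H0 z1) := by rw [← s1]; module
      _ = _ := by rw [← f0]; module

/-- The augmentation `E3` kills boundaries. -/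
lemma Good.E3_D (hX : X.Good t) {v : V} (hv : v ∈ X.gr 4 3) : X.E3 (X.D v) = 0 := by
  obtain ⟨v1, e1⟩ : ∃ w, w = X.σ 0 (X.D v) - X.D (X.σ 0 v) := ⟨_, rfl⟩
  obtain ⟨v2, e2⟩ : ∃ w, w = X.σ 1 (X.D v1) - X.D (X.σ 1 v1) := ⟨_, rfl⟩
  obtain ⟨v3, e3⟩ : ∃ w, w = X.σ 2 (X.D v2) - X.D (X.σ 2 v2) := ⟨_, rfl⟩
  have g1 : v1 ∈ X.gr 3 2 := by
    rw [e1]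
    exact Submodule.sub_mem _ (hX.gr_σ 0 (hX.gr_D hv)) (hX.gr_D (hX.gr_σ 0 hv))
  have g2 : v2 ∈ X.gr 2 1 := by
    rw [e2]
    exact Submodule.sub_mem _ (hX.gr_σ 1 (hX.gr_D g1)) (hX.gr_D (hX.gr_σ 1 g1))
  have g3 : v3 ∈ X.gr 1 0 := by
    rw [e3]
    exact Submodule.sub_mem _ (hX.gr_σ 2 (hX.gr_D g2)) (hX.gr_D (hX.gr_σ 2 g2))
  have y01 : X.y 0 v1 = 0 := by rw [e1, map_sub, hX.y_σ_self, ← hX.D_y, hX.y_σ_self, sub_self]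
  have y12 : X.y 1 v2 = 0 := by rw [e2, map_sub, hX.y_σ_self, ← hX.D_y, hX.y_σ_self, sub_self]
  have y02 : X.y 0 v2 = 0 := by
    rw [e2, map_sub, hX.y_σ 0 1 (by decide), ← hX.D_y, ← hX.D_y, hX.y_σ 0 1 (by decide), y01]
    simp
  have y23 : X.y 2 v3 = 0 := by rw [e3, map_sub, hX.y_σ_self, ← hX.D_y, hX.y_σ_self, sub_self]
  have y03 : X.y 0 v3 = 0 := by
    rw [e3, map_sub, hX.y_σ 0 2 (by decide), ← hX.D_y, ← hX.D_y, hX.y_σ 0 2 (by decide), y02]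
    simp
  have y13 : X.y 1 v3 = 0 := by
    rw [e3, map_sub, hX.y_σ 1 2 (by decide), ← hX.D_y, ← hX.D_y, hX.y_σ 1 2 (by decide), y12]
    simp
  have v30 : v3 = 0 :=
    hX.ker g3 le_rfl (fun q => by fin_cases q <;> assumption) (Or.inr (Or.inl (by decide)))
  have r1 : X.D v1 = X.D (X.σ 0 (X.D v)) := by rw [e1, map_sub, hX.D_D, sub_zero]
  have r2 : X.D v2 = X.D (X.σ 1 (X.D v1)) := by rw [e2, map_sub, hX.D_D, sub_zero]
  have r3 : X.D v3 = X.D (X.σ 2 (X.D v2)) := by rw [e3, map_sub, hX.D_D, sub_zero]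
  rw [E3_apply, ← r1, ← r2, ← r3, v30]
  simp

end StrandData
end Homotopy

section Image

variable {R : Type} [CommRing R] {V : Type} [AddCommGroup V] [Module R V]

namespace StrandData

/-- The coefficients of the operators `(a × y)_p`. -/
def crossCoeff (a : Fin 3 → R) (p k : Fin 3) : R :=
  if k = p + 2 then a (p + 1) else if k = p + 1 then - a (p + 2) else 0

lemma crossOp_eq_sum (a : Fin 3 → R) (y : Fin 3 → V →ₗ[R] V) (p : Fin 3) (v : V) :
    crossOp a y p v = ∑ k, crossCoeff a p k • y k v := by
  fin_cases p <;> simp [crossOp_apply, Fin.sum_univ_three, crossCoeff] <;> module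

def E1 (X : StrandData R V) (k : Fin 3) : V →ₗ[R] R := X.τ ∘ₗ X.D ∘ₗ X.σ k

def E2 (X : StrandData R V) (k l : Fin 3) : V →ₗ[R] R := X.τ ∘ₗ X.D ∘ₗ X.σ l ∘ₗ X.D ∘ₗ X.σ k

lemma E1_apply (X : StrandData R V) (k : Fin 3) (v : V) : X.E1 k v = X.τ (X.D (X.σ k v)) := rfl

lemma E2_apply (X : StrandData R V) (k l : Fin 3) (v : V) :
    X.E2 k l v = X.E1 l (X.D (X.σ k v)) := rfl

lemma E3_eq (X : StrandData R V) (v : V) : X.E3 v = X.E2 1 2 (X.D (X.σ 0 v)) := rfl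

variable {X : StrandData R V} {t : ℤ} (hX : X.Good t)
include hX

lemma Good.y_diag {i : ℤ} {v : V} (hv : v ∈ X.gr i i) (q : Fin 3) : X.y q v = 0 :=
  hX.gr_lt (by omega) (hX.gr_y q hv)

lemma Good.y_σ_diag {i : ℤ} {v : V} (hv : v ∈ X.gr i i) (q k : Fin 3) :
    X.y q (X.σ k v) = if q = k then v else 0 := by
  split_ifs with h
  · rw [h, hX.y_σ_self]
  · rw [hX.y_σ _ _ h, hX.y_diag hv, map_zero]

lemma Good.cross_σ_diag {i : ℤ} {v : V} (hv : v ∈ X.gr i i) (a : Fin 3 → R) (p k : Fin 3) :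
    crossOp a X.y p (X.σ k v) = crossCoeff a p k • v := by
  simp [crossOp_eq_sum, hX.y_σ_diag hv]

lemma Good.step_D_σ_diag (a : Fin 3 → R) {i : ℤ} {z : StepV V} (hz : z ∈ (X.step a).gr i i)
    (k : Fin 3) : (X.step a).D ((X.step a).σ k z) =
      (X.D (X.σ k z.1) + ∑ p, crossCoeff a p k • z.2.1 p,
        fun p => - X.D (X.σ k (z.2.1 p)) + (if p = k then z.2.2.2 else 0), 0,
        X.D (X.σ k z.2.2.2)) := by
  rw [mem_step_gr] at hz
  obtain ⟨-, h2, h3, h4⟩ := hz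
  have h30 : z.2.2.1 = 0 := hX.gr_lt (by omega) h3
  simp [h30, hX.cross_σ_diag (h2 _), hX.y_σ_diag h4]

lemma Good.step_E1 (a : Fin 3 → R) {z : StepV V} (hz : z ∈ (X.step a).gr 1 1) (k : Fin 3) :
    (X.step a).E1 k z = X.E1 k z.1 + ∑ p, crossCoeff a p k * X.τ (z.2.1 p) := by
  rw [E1_apply, hX.step_D_σ_diag a hz]
  simp [E1_apply]

lemma Good.step_E2 (a : Fin 3 → R) {z : StepV V} (hz : z ∈ (X.step a).gr 2 2) (k l : Fin 3) :
    (X.step a).E2 k l z = X.E2 k l z.1 + ∑ p, (crossCoeff a p k * X.E1 l (z.2.1 p)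
      - crossCoeff a p l * X.E1 k (z.2.1 p)) + crossCoeff a k l * X.τ z.2.2.2 := by
  rw [E2_apply, hX.step_E1 a ((hX.step a).gr_D ((hX.step a).gr_σ k hz)),
    hX.step_D_σ_diag a hz]
  simp only [map_add, map_sum, map_smul, smul_eq_mul, ← E2_apply, map_neg, ← E1_apply, mul_add,
    Finset.sum_add_distrib, mul_neg, Finset.sum_sub_distrib, Finset.sum_neg_distrib,
    apply_ite X.τ, map_zero, mul_ite, mul_zero, Finset.sum_ite_eq', Finset.mem_univ, if_true]
  ring

lemma Good.step_E3 (a : Fin 3 → R) {z : StepV V} (hz : z ∈ (X.step a).gr 3 3) :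
    (X.step a).E3 z = X.E3 z.1 + ∑ p, (crossCoeff a p 0 * X.E2 1 2 (z.2.1 p)
      - crossCoeff a p 1 * X.E2 0 2 (z.2.1 p) + crossCoeff a p 2 * X.E2 0 1 (z.2.1 p))
      - ∑ k, a k * X.E1 k z.2.2.2 := by
  rw [E3_eq, hX.step_E2 a ((hX.step a).gr_D ((hX.step a).gr_σ 0 hz)),
    hX.step_D_σ_diag a hz]
  simp only [map_add, map_sum, map_smul, smul_eq_mul, ← E3_eq, map_neg, ← E1_apply, ← E2_apply]
  simp [Fin.sum_univ_three, crossCoeff]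
  ring

omit hX

/-- The image of the augmentation after processing the rows in `L`, all rows being in `S`. -/
structure Img (X : StrandData R V) (I : Ideal R) (S : Set (Fin 3 → R)) (L : List (Fin 3 → R)) :
    Prop where
  sub1 : ∀ b ∈ S, ∀ z ∈ X.gr 1 1, ∑ k, b k * X.E1 k z ∈ I
  sub2 : ∀ b ∈ S, ∀ p, ∀ z ∈ X.gr 2 2, crossCoeff b p 0 * X.E2 1 2 z -
    crossCoeff b p 1 * X.E2 0 2 z + crossCoeff b p 2 * X.E2 0 1 z ∈ I
  sub3 : ∀ z ∈ X.gr 3 3, X.E3 z ∈ I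
  sup1 : ∀ b ∈ L, ∀ p, ∃ z ∈ X.gr 1 1, ∀ k, X.E1 k z = crossCoeff b p k
  sup3 : ∀ a ∈ L, ∀ b ∈ L, ∀ p, ∃ z ∈ X.gr 3 3,
    X.E3 z = a (p + 1) * b (p + 2) - a (p + 2) * b (p + 1)

lemma img_base (I : Ideal R) (S : Set (Fin 3 → R)) : (base R).Img I S [] where
  sub1 b _ z _ := by simp [E1_apply, base_D]
  sub2 b _ p z _ := by simp [E2_apply, E1_apply, base_D]
  sub3 z _ := by simp [E3_eq, E2_apply, E1_apply, base_D]
  sup1 b hb := by simp at hb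
  sup3 b hb := by simp at hb

include hX in
lemma Good.img_step {I : Ideal R} {S : Set (Fin 3 → R)} {L : List (Fin 3 → R)}
    (hS : ∀ a ∈ S, ∀ b ∈ S, ∀ p, a (p + 1) * b (p + 2) - a (p + 2) * b (p + 1) ∈ I)
    (h : X.Img I S L) {a : Fin 3 → R} (ha : a ∈ S) : (X.step a).Img I S (a :: L) := by
  have hinj : ∀ {i z}, z ∈ X.gr i i → ((z, 0, 0, 0) : StepV V) ∈ (X.step a).gr i i :=
    fun hz => by simp [mem_step_gr, hz]
  refine ⟨fun b hb z hz => ?_, fun b hb p z hz => ?_, fun z hz => ?_, fun b hb p => ?_,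
    fun b hb c hc p => ?_⟩
  · simp only [hX.step_E1 a hz, mul_add, Finset.sum_add_distrib]
    rw [mem_step_gr] at hz
    refine I.add_mem (h.sub1 b hb _ hz.1) ?_
    have : ∑ k, b k * ∑ p, crossCoeff a p k * X.τ (z.2.1 p) =
        ∑ p, (a (p + 1) * b (p + 2) - a (p + 2) * b (p + 1)) * X.τ (z.2.1 p) := by
      simp [Fin.sum_univ_three, crossCoeff]
      ring
    rw [this]
    exact I.sum_mem fun p _ => I.mul_mem_right _ (hS a ha b hb p)
  · simp only [hX.step_E2 a hz]
    rw [mem_step_gr] at hz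
    obtain ⟨h1, h2, h3, h4⟩ := hz
    have k1 := h.sub2 b hb p _ h1
    have k2 := fun q => h.sub1 a ha _ (h2 q)
    have k3 := hS a ha b hb
    have k4 : ∀ q, ((a (q + 1) * b (q + 2) - a (q + 2) * b (q + 1)) * X.τ z.2.2.2) ∈ I :=
      fun q => I.mul_mem_right _ (k3 q)
    have k5 : ∀ q r s, ((a (q + 1) * b (q + 2) - a (q + 2) * b (q + 1)) * X.E1 r (z.2.1 s)) ∈ I :=
      fun q r s => I.mul_mem_right _ (k3 q)
    have k6 : ∀ r q, b r * ∑ k, a k * X.E1 k (z.2.1 q) ∈ I := fun r q => I.mul_mem_left _ (k2 q)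
    simp only [Fin.sum_univ_three] at k1 k6 ⊢
    have := I.add_mem k1 (I.add_mem (I.sub_mem (I.sub_mem (k6 (p + 2) (p + 1))
      (k6 (p + 1) (p + 2))) (I.add_mem (I.add_mem (k5 p 0 0) (k5 p 1 1)) (k5 p 2 2))) (k4 p))
    convert this using 1
    fin_cases p <;> simp [crossCoeff] <;> ring
  · rw [hX.step_E3 a hz]
    rw [mem_step_gr] at hz
    exact I.sub_mem (I.add_mem (h.sub3 _ hz.1) (I.sum_mem fun p _ => h.sub2 a ha p _ (hz.2.1 p)))
      (h.sub1 a ha _ hz.2.2.2)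
  · rcases List.mem_cons.1 hb with rfl | hb
    · obtain ⟨u, hu, hu1⟩ := hX.one
      have hm : ((0, Pi.single p u, 0, 0) : StepV V) ∈ (X.step b).gr 1 1 := by
        simp only [mem_step_gr, Submodule.zero_mem, true_and, and_self, and_true]
        intro q
        by_cases hq : q = p
        · subst hq; simpa using hu
        · simp [hq]
      refine ⟨_, hm, fun k => ?_⟩
      rw [hX.step_E1 b hm]
      simp [Pi.single_apply, apply_ite X.τ, hu1]
    · obtain ⟨z, hz, hk⟩ := h.sup1 b hb p
      refine ⟨_, hinj hz, fun k => ?_⟩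
      rw [hX.step_E1 a (hinj hz)]
      simp [hk]
  · have mixed : ∀ b ∈ L, ∀ p, ∃ z ∈ (X.step a).gr 3 3,
        (X.step a).E3 z = a (p + 1) * b (p + 2) - a (p + 2) * b (p + 1) := fun b hb p => by
      obtain ⟨z, hz, hk⟩ := h.sup1 b hb p
      have hm : ((0, 0, 0, z) : StepV V) ∈ (X.step a).gr 3 3 := by
        simpa [mem_step_gr] using hz
      refine ⟨_, hm, ?_⟩
      rw [hX.step_E3 a hm]
      fin_cases p <;> simp [hk, Fin.sum_univ_three, crossCoeff]
      all_goals ring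
    rcases List.mem_cons.1 hb with hb' | hb' <;> rcases List.mem_cons.1 hc with hc' | hc'
    · exact ⟨0, Submodule.zero_mem _, by rw [map_zero, hb', hc']; ring⟩
    · rw [hb']; exact mixed c hc' p
    · obtain ⟨z, hz, h⟩ := mixed b hb' p
      exact ⟨-z, Submodule.neg_mem _ hz, by rw [map_neg, h, hc']; ring⟩
    · obtain ⟨z, hz, hk⟩ := h.sup3 b hb' c hc' p
      refine ⟨_, hinj hz, ?_⟩
      rw [hX.step_E3 a (hinj hz)]
      simp [hk]

end StrandData
end Image

section LinearForms

open MvPolynomial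

variable {R : Type} [CommRing R]

/-- The linear form `(a × X)_p`. -/
def rowForm (a : Fin 3 → R) (p : Fin 3) : MvPolynomial (Fin 3) R :=
  C (a (p + 1)) * X (p + 2) - C (a (p + 2)) * X (p + 1)

/-- The ideal generated by the linear forms `(a × X)_p` for `a ∈ L`. -/
def rowIdeal (L : List (Fin 3 → R)) : Ideal (MvPolynomial (Fin 3) R) :=
  Ideal.span {f | ∃ a ∈ L, ∃ p, f = rowForm a p}

lemma rowForm_isHomogeneous (a : Fin 3 → R) (p : Fin 3) : (rowForm a p).IsHomogeneous 1 := by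
  refine IsHomogeneous.sub ?_ ?_
  · simpa using (isHomogeneous_C (Fin 3) (a (p + 1))).mul (isHomogeneous_X R (p + 2))
  · simpa using (isHomogeneous_C (Fin 3) (a (p + 2))).mul (isHomogeneous_X R (p + 1))

lemma rowForm_mem {L : List (Fin 3 → R)} {a : Fin 3 → R} (ha : a ∈ L) (p : Fin 3) :
    rowForm a p ∈ rowIdeal L := Ideal.subset_span ⟨a, ha, p, rfl⟩

lemma rowIdeal_le_cons (L : List (Fin 3 → R)) (a : Fin 3 → R) : rowIdeal L ≤ rowIdeal (a :: L) :=
  Ideal.span_mono fun _ ⟨b, hb, p, h⟩ => ⟨b, List.mem_cons_of_mem _ hb, p, h⟩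

lemma exists_eq_C_add_sum_X_mul (f : MvPolynomial (Fin 3) R) :
    ∃ (r : R) (g : Fin 3 → MvPolynomial (Fin 3) R), f = C r + ∑ p, X p * g p := by
  induction f using MvPolynomial.induction_on with
  | C r => exact ⟨r, 0, by simp⟩
  | add f f' hf hf' =>
    obtain ⟨r, g, rfl⟩ := hf
    obtain ⟨r', g', rfl⟩ := hf'
    exact ⟨r + r', g + g', by simp [mul_add, Finset.sum_add_distrib]; ring⟩
  | mul_X f p hf =>
    exact ⟨0, Pi.single p f, by simp [Pi.single_apply, mul_comm]⟩

lemma homogeneousComponent_X_mul (e : ℕ) (p : Fin 3) (f : MvPolynomial (Fin 3) R) :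
    homogeneousComponent (e + 1) (X p * f) = X p * homogeneousComponent e f := by
  ext α
  rw [coeff_homogeneousComponent, coeff_X_mul', coeff_X_mul', coeff_homogeneousComponent]
  by_cases h : p ∈ α.support
  · have hα : α = (α - Finsupp.single p 1) + Finsupp.single p 1 := by
      rw [tsub_add_cancel_of_le]
      simpa using Nat.one_le_iff_ne_zero.2 (Finsupp.mem_support_iff.1 h)
    have h3 := congrArg Finsupp.degree hα
    simp only [map_add, Finsupp.degree_single] at h3
    simp only [h, if_true]
    congr 1
    simp only [eq_iff_iff]
    omega
  · simp [h]

lemma IsHomogeneous.exists_sum_X_mul {e : ℕ} {Q : MvPolynomial (Fin 3) R}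
    (hQ : Q.IsHomogeneous (e + 1)) :
    ∃ g : Fin 3 → MvPolynomial (Fin 3) R, (∀ p, (g p).IsHomogeneous e) ∧
      Q = ∑ p, X p * g p := by
  obtain ⟨r, g, h⟩ := exists_eq_C_add_sum_X_mul Q
  refine ⟨fun p => homogeneousComponent e (g p),
    fun p => homogeneousComponent_isHomogeneous _ _, ?_⟩
  have h2 := congrArg (homogeneousComponent (e + 1)) h
  rw [homogeneousComponent_of_mem hQ, if_pos rfl, map_add, map_sum,
    homogeneousComponent_of_mem (isHomogeneous_C (Fin 3) r), if_neg (by omega), zero_add] at h2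
  rw [h2]
  simp [homogeneousComponent_X_mul]

lemma exists_of_mem_rowIdeal {L : List (Fin 3 → R)} {f : MvPolynomial (Fin 3) R}
    (hf : f ∈ rowIdeal L) : ∃ l ∈ rowIdeal L, l.IsHomogeneous 1 ∧
      ∃ B : Fin 3 → MvPolynomial (Fin 3) R, (∀ p, B p ∈ rowIdeal L) ∧ f = l + ∑ p, X p * B p := by
  induction hf using Submodule.span_induction with
  | mem x h =>
    obtain ⟨a, ha, p, rfl⟩ := h
    exact ⟨_, rowForm_mem ha p, rowForm_isHomogeneous a p, 0, fun p => zero_mem _, by simp⟩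
  | zero => exact ⟨0, zero_mem _, isHomogeneous_zero _ _ _, 0, fun p => zero_mem _, by simp⟩
  | add x y _ _ hx hy =>
    obtain ⟨l, h1, h2, B, h3, rfl⟩ := hx
    obtain ⟨l', h1', h2', B', h3', rfl⟩ := hy
    exact ⟨l + l', add_mem h1 h1', h2.add h2', B + B', fun p => add_mem (h3 p) (h3' p), by
      simp [mul_add, Finset.sum_add_distrib]; ring⟩
  | smul s x _ hx =>
    obtain ⟨l, h1, h2, B, h3, rfl⟩ := hx
    obtain ⟨r, g, rfl⟩ := exists_eq_C_add_sum_X_mul s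
    refine ⟨C r * l, Ideal.mul_mem_left _ _ h1, by
      simpa using (isHomogeneous_C (Fin 3) r).mul h2,
      fun p => g p * l + (C r + ∑ p, X p * g p) * B p,
      fun p => add_mem (Ideal.mul_mem_left _ _ h1) (Ideal.mul_mem_left _ _ (h3 p)), ?_⟩
    simp [Fin.sum_univ_three]
    ring

lemma constantCoeff_of_mem_rowIdeal {L : List (Fin 3 → R)} {f : MvPolynomial (Fin 3) R}
    (hf : f ∈ rowIdeal L) : constantCoeff f = 0 := by
  have : rowIdeal L ≤ RingHom.ker (constantCoeff (R := R) (σ := Fin 3)) := by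
    refine Ideal.span_le.2 ?_
    rintro _ ⟨a, _, p, rfl⟩
    simp [rowForm, RingHom.mem_ker]
  exact this hf

lemma exists_sum_X_mul_of_mem_rowIdeal {L : List (Fin 3 → R)} {f : MvPolynomial (Fin 3) R}
    (hf : f ∈ rowIdeal L) {e : ℕ} (he : 2 ≤ e) (hfe : f.IsHomogeneous e) :
    ∃ B : Fin 3 → MvPolynomial (Fin 3) R, (∀ p, B p ∈ rowIdeal L) ∧ f = ∑ p, X p * B p := by
  obtain ⟨l, h1, h2, B, h3, h⟩ := exists_of_mem_rowIdeal hf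
  refine ⟨B, h3, ?_⟩
  have k := congrArg (homogeneousComponent 1) h
  rw [homogeneousComponent_of_mem hfe, if_neg (by omega), map_add, map_sum,
    homogeneousComponent_of_mem h2, if_pos rfl] at k
  have k2 : ∀ p, homogeneousComponent 1 (X p * B p) = 0 := fun p => by
    rw [homogeneousComponent_X_mul 0, homogeneousComponent_zero,
      ← constantCoeff_eq, constantCoeff_of_mem_rowIdeal (h3 p)]
    simp
  simp only [k2, Finset.sum_const_zero, add_zero] at k
  rw [h, ← k, zero_add]

lemma eq_zero_of_X_mul_eq_zero {p : Fin 3} {Y : MvPolynomial (Fin 3) R} (h : X p * Y = 0) :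
    Y = 0 := by
  rw [← X_mul_divMonomial p Y, h, zero_divMonomial]

lemma eq_zero_of_eq_X_mul {p : Fin 3} {S Y : MvPolynomial (Fin 3) R}
    (hS : ∀ α : Fin 3 →₀ ℕ, α p ≠ 0 → coeff α S = 0) (h : S = X p * Y) : S = 0 := by
  ext α
  by_cases hα : α p = 0
  · rw [h, coeff_X_mul', if_neg (by simpa using hα), coeff_zero]
  · rw [hS α hα, coeff_zero]

lemma coeff_modMonomial_single_of_ne (p : Fin 3) (W : MvPolynomial (Fin 3) R) (α : Fin 3 →₀ ℕ)
    (hα : α p ≠ 0) : coeff α (W.modMonomial (Finsupp.single p 1)) = 0 :=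
  coeff_modMonomial_of_le _ (by simpa using Nat.one_le_iff_ne_zero.2 hα)

lemma coeff_X_mul_of_ne {p q : Fin 3} (hpq : q ≠ p) {S : MvPolynomial (Fin 3) R}
    (hS : ∀ α : Fin 3 →₀ ℕ, α p ≠ 0 → coeff α S = 0) (α : Fin 3 →₀ ℕ) (hα : α p ≠ 0) :
    coeff α (X q * S) = 0 := by
  rw [coeff_X_mul']
  split_ifs
  · exact hS _ (by simpa [Finsupp.single_apply, hpq] using hα)
  · rfl

/-- Exactness of the Koszul complex on three variables, in the first relevant degree. -/
lemma exists_koszul {W : Fin 3 → MvPolynomial (Fin 3) R} (h : ∑ p, X p * W p = 0) :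
    ∃ U : Fin 3 → MvPolynomial (Fin 3) R,
      ∀ p, W p = X (p + 1) * U (p + 2) - X (p + 2) * U (p + 1) := by
  rw [Fin.sum_univ_three] at h
  have e1 := divMonomial_add_modMonomial_single (W 1) 0
  have e2 := divMonomial_add_modMonomial_single (W 2) 0
  have n1 := coeff_modMonomial_single_of_ne 0 (W 1)
  have n2 := coeff_modMonomial_single_of_ne 0 (W 2)
  generalize divMonomial (W 1) (Finsupp.single 0 1) = A at e1
  generalize divMonomial (W 2) (Finsupp.single 0 1) = B at e2
  generalize modMonomial (W 1) (Finsupp.single 0 1) = S at e1 n1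
  generalize modMonomial (W 2) (Finsupp.single 0 1) = T at e2 n2
  have k1 : X 1 * S + X 2 * T = X 0 * (-(W 0 + X 1 * A + X 2 * B)) := by
    rw [← e1, ← e2] at h
    linear_combination h
  have k2 := eq_zero_of_eq_X_mul (fun α hα => by
    rw [coeff_add, coeff_X_mul_of_ne (by decide) n1 α hα, coeff_X_mul_of_ne (by decide) n2 α hα,
      add_zero]) k1
  rw [k2] at k1
  have k3 := eq_zero_of_X_mul_eq_zero k1.symm
  have e3 := divMonomial_add_modMonomial_single S 2
  have n3 := coeff_modMonomial_single_of_ne 2 S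
  generalize divMonomial S (Finsupp.single 2 1) = F at e3
  generalize modMonomial S (Finsupp.single 2 1) = S' at e3 n3
  have k4 : X 1 * S' = X 2 * (-(T + X 1 * F)) := by
    rw [← e3] at k2
    linear_combination k2
  have k5 := eq_zero_of_eq_X_mul (coeff_X_mul_of_ne (by decide) n3) k4
  rw [k5] at k4
  have k6 := eq_zero_of_X_mul_eq_zero k4.symm
  have k7 := eq_zero_of_X_mul_eq_zero k5
  refine ⟨![F, B, -A], fun p => ?_⟩
  fin_cases p
  · simp
    linear_combination -k3
  · simp
    linear_combination -e1 - e3 + k7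
  · simp
    linear_combination -e2 - k6

end LinearForms

section TopDegree

open MvPolynomial

variable {R : Type} [CommRing R] {V : Type} [AddCommGroup V] [Module R V]

namespace StrandData

/-- The functionals on the top homological degree modulo coboundaries are given by polynomials
modulo the ideal of linear forms. -/
structure Top (X : StrandData R V) (t m : ℤ) (L : List (Fin 3 → R)) : Prop where
  surj : ∀ (e : ℕ) (φ : V →ₗ[R] R), ∃ P : MvPolynomial (Fin 3) R, P.IsHomogeneous e ∧
    ∃ ψ : V →ₗ[R] R, ∀ v ∈ X.gr t (m - e), φ v = X.Ψ P v + ψ (X.D v)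
  mem : ∀ e : ℕ, 1 ≤ e → ∀ P : MvPolynomial (Fin 3) R, P.IsHomogeneous e →
    ∀ ψ : V →ₗ[R] R, (∀ v ∈ X.gr t (m - e), X.Ψ P v = ψ (X.D v)) → P ∈ rowIdeal L

lemma top_base : (base R).Top 0 0 [] where
  surj e φ := by
    classical
    have := finite_degree (e : ℤ)
    let := Fintype.ofFinite {α : Fin 3 →₀ ℕ // (α.degree : ℤ) = e}
    refine ⟨∑ α : {α : Fin 3 →₀ ℕ // (α.degree : ℤ) = e}, monomial α.1 (φ (Pi.single α.1 1)),
      IsHomogeneous.sum _ _ _ fun α _ => isHomogeneous_monomial _ (by exact_mod_cast α.2), 0,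
      fun v hv => ?_⟩
    have hv' : v = ∑ α : {α : Fin 3 →₀ ℕ // (α.degree : ℤ) = e}, v α.1 • Pi.single α.1 (1 : R) := by
      ext β
      simp only [Finset.sum_apply, Pi.smul_apply, Pi.single_apply,
          smul_eq_mul, mul_ite, mul_one, mul_zero]
      by_cases hβ : (β.degree : ℤ) = e
      · rw [Finset.sum_eq_single ⟨β, hβ⟩]
        · simp
        · intro γ _ hγ
          rw [if_neg]
          rintro rfl
          exact hγ rfl
        · simp
      · rw [Finset.sum_eq_zero]
        · by_contra hc
          have := (hv β hc).2
          omega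
        · intro γ _
          rw [if_neg]
          rintro rfl
          exact hβ γ.2
    rw [map_sum, LinearMap.sum_apply]
    simp only [base_Ψ_monomial]
    conv_lhs => rw [hv']
    simp [mul_comm]
  mem e _ P hP ψ h := by
    classical
    have : P = 0 := by
      ext α
      by_cases hα : α.degree = e
      · have h1 := h (Pi.single α 1) (fun β hβ => by
          by_cases h0 : β = α
          · subst h0; simp [hα]
          · simp [h0] at hβ)
        rw [base_D, map_zero] at h1
        have h2 : ∀ (P : MvPolynomial (Fin 3) R) (f : (Fin 3 →₀ ℕ) → R) , f = Pi.single α 1 →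
            (base R).Ψ P f = coeff α P := fun P f hf => by
          induction P using MvPolynomial.induction_on' with
          | monomial β r =>
            rw [base_Ψ_monomial, coeff_monomial, hf]
            by_cases h0 : β = α <;> simp [h0]
          | add P Q hP hQ => simp only [map_add, LinearMap.add_apply, hP, hQ, coeff_add]
        rw [h2 _ _ rfl] at h1
        rw [h1, coeff_zero]
      · rw [hP.coeff_eq_zero hα, coeff_zero]
    rw [this]
    exact zero_mem _

variable {X : StrandData R V} {t : ℤ} (hX : X.Good t)
include hX

lemma Good.Ψ_rowForm_mul (a : Fin 3 → R) (p : Fin 3) (U : MvPolynomial (Fin 3) R) (v : V) :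
    X.Ψ (U * rowForm a p) v = X.Ψ U (crossOp a X.y p v) := by
  have : U * rowForm a p = a (p + 1) • (MvPolynomial.X (p + 2) * U) -
      a (p + 2) • (MvPolynomial.X (p + 1) * U) := by
    simp only [rowForm, smul_eq_C_mul]
    ring
  rw [this, map_sub, map_smul, map_smul, crossOp_apply]
  simp [hX.Ψ_X_mul]

/-- Polynomials in the row ideal give coboundaries in the top degree. -/
lemma Good.exists_coboundary {L : List (Fin 3 → R)}
    (hL : ∀ a ∈ L, ∀ p, X.NullHtpy (crossOp a X.y p)) {P : MvPolynomial (Fin 3) R}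
    (hP : P ∈ rowIdeal L) (δ : ℤ) :
    ∃ ψ : V →ₗ[R] R, ∀ v ∈ X.gr t δ, X.Ψ P v = ψ (X.D v) := by
  induction hP using Submodule.closure_induction with
  | zero => exact ⟨0, fun v _ => by simp⟩
  | add P Q _ _ hP hQ =>
    obtain ⟨ψ, h⟩ := hP
    obtain ⟨ψ', h'⟩ := hQ
    exact ⟨ψ + ψ', fun v hv => by simp [h v hv, h' v hv]⟩
  | smul_mem U x h =>
    obtain ⟨a, ha, p, rfl⟩ := h
    obtain ⟨h, h1, -, h3⟩ := hL a ha p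
    refine ⟨X.Ψ U ∘ₗ h, fun v hv => ?_⟩
    have h0 : h v = 0 := hX.gr_top (by omega) (h3 hv)
    rw [smul_eq_mul, hX.Ψ_rowForm_mul, ← h1, h0]
    simp

lemma Good.top_step {m : ℤ} {L : List (Fin 3 → R)} (h : X.Top t m L) (a : Fin 3 → R) :
    (X.step a).Top (t + 2) (m + 1) (a :: L) where
  surj e φ := by
    obtain ⟨Q, hQ, ψf, hf⟩ := h.surj (e + 1)
      (φ ∘ₗ LinearMap.inr R _ _ ∘ₗ LinearMap.inr R _ _ ∘ₗ LinearMap.inr R _ _)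
    obtain ⟨P, hP, ψg, hg⟩ := h.surj e
      (φ ∘ₗ LinearMap.inr R _ _ ∘ₗ LinearMap.inr R _ _ ∘ₗ LinearMap.inl R _ _)
    obtain ⟨q, hq, rfl⟩ := IsHomogeneous.exists_sum_X_mul hQ
    refine ⟨P - ∑ p, C (a p) * q p, hP.sub (IsHomogeneous.sum _ _ _ fun p _ => by
      simpa using (isHomogeneous_C (Fin 3) (a p)).mul (hq p)),
      LinearMap.coprod 0 (LinearMap.coprod (∑ p, X.Ψ (q p) ∘ₗ LinearMap.proj p)
        (LinearMap.coprod ψg ψf)), fun v hv => ?_⟩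
    rw [mem_step_gr] at hv
    obtain ⟨h1, h2, h3, h4⟩ := hv
    have v1 : v.1 = 0 := hX.gr_top (by omega) h1
    have v2 : v.2.1 = 0 := funext fun p => hX.gr_top (by omega) (h2 p)
    have e3 : v.2.2.1 ∈ X.gr t (m - e) := by convert h3 using 2 <;> omega
    have e4 : v.2.2.2 ∈ X.gr t (m - ↑(e + 1)) := by
      convert h4 using 2
      · omega
      · push_cast; omega
    have hv' : v = (0, 0, v.2.2.1, 0) + (0, 0, 0, v.2.2.2) := by
      ext <;> simp [v1, v2]
    have hf' := hf _ e4
    have hg' := hg _ e3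
    simp only [LinearMap.comp_apply, LinearMap.inr_apply, LinearMap.inl_apply]
      at hf' hg'
    simp only [map_sum, LinearMap.sum_apply, hX.Ψ_X_mul] at hf'
    conv_lhs => rw [hv', map_add, hf', hg']
    simp [v2, ← smul_eq_C_mul, Finset.sum_add_distrib]
    ring
  mem e he P hP ψ hψ := by
    obtain ⟨ψe, hψe⟩ : ∃ ψe : Fin 3 → V →ₗ[R] R, ∀ p, ψe p = ψ ∘ₗ LinearMap.inr R _ _ ∘ₗ
      LinearMap.inl R _ _ ∘ₗ LinearMap.single R (fun _ => V) p := ⟨_, fun _ => rfl⟩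
    have hψe' : ∀ u : Fin 3 → V, ψ (0, u, 0, 0) = ∑ p, ψe p (u p) := fun u => by
      have : (0, u, 0, 0) = ∑ p, ((0, Pi.single p (u p), 0, 0) : StepV V) := by
        ext <;> simp [Prod.fst_sum, Prod.snd_sum, Pi.single_apply]
      rw [this, map_sum]
      exact Finset.sum_congr rfl fun p _ => by rw [hψe]; rfl
    have hg : ∀ v ∈ X.gr t (m - e), X.Ψ P v =
        ∑ p, ψe p (a p • v) + ψ (0, 0, X.D v, 0) := fun v hv => by
      have := hψ (0, 0, v, 0) (by
        simp only [mem_step_gr, Submodule.zero_mem, true_and, and_true, Pi.zero_apply, implies_true]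
        convert hv using 2 <;> omega)
      simp only [step_Ψ, step_D] at this
      rw [this, ← hψe', ← map_add]
      congr 1
      ext <;> simp
    have hf : ∀ v ∈ X.gr t (m - ↑(e + 1)), ∑ p, ψe p (X.y p v) + ψ (0, 0, 0, X.D v) = 0 :=
        fun v hv => by
      have := hψ (0, 0, 0, v) (by
        simp only [mem_step_gr, Submodule.zero_mem, true_and, Pi.zero_apply, implies_true]
        convert hv using 2
        · omega
        · push_cast; omega)
      simp only [step_Ψ, step_D, map_zero] at this
      rw [this, ← hψe', ← map_add]
      congr 1
      ext <;> simp
    choose q hq ρ hρ using fun p => h.surj e (ψe p)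
    have m1 : ∑ p, MvPolynomial.X p * q p ∈ rowIdeal L := by
      refine h.mem (e + 1) (by omega) _ (IsHomogeneous.sum _ _ _ fun p _ => by
        simpa [add_comm] using (isHomogeneous_X R p).mul (hq p))
        (- ∑ p, ρ p ∘ₗ X.y p - ψ ∘ₗ LinearMap.inr R _ _ ∘ₗ LinearMap.inr R _ _ ∘ₗ
          LinearMap.inr R _ _) fun v hv => ?_
      have h1 : ∀ p, X.y p v ∈ X.gr t (m - e) := fun p => by
        convert hX.gr_y p hv using 2; push_cast; ring
      have h2 := hf v hv
      simp only [hρ _ _ (h1 _), hX.D_y, Finset.sum_add_distrib] at h2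
      simp only [map_sum, LinearMap.sum_apply, hX.Ψ_X_mul, LinearMap.sub_apply, LinearMap.neg_apply,
        LinearMap.comp_apply, LinearMap.inr_apply]
      linear_combination h2
    have m2 : P - ∑ p, C (a p) * q p ∈ rowIdeal L := by
      refine h.mem e he _ (hP.sub (IsHomogeneous.sum _ _ _ fun p _ => by
        simpa using (isHomogeneous_C (Fin 3) (a p)).mul (hq p)))
        (∑ p, a p • ρ p + ψ ∘ₗ LinearMap.inr R _ _ ∘ₗ LinearMap.inr R _ _ ∘ₗ
          LinearMap.inl R _ _) fun v hv => ?_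
      simp only [map_sub, map_sum, LinearMap.sub_apply, LinearMap.sum_apply, ← smul_eq_C_mul,
        map_smul, LinearMap.smul_apply, hg v hv, hρ _ v hv, smul_add, Finset.sum_add_distrib,
        LinearMap.add_apply, LinearMap.comp_apply, LinearMap.inr_apply, LinearMap.inl_apply]
      ring
    obtain ⟨B, hB, hqB⟩ := exists_sum_X_mul_of_mem_rowIdeal m1 (e := e + 1) (by omega)
      (IsHomogeneous.sum _ _ _ fun p _ => by
        simpa [add_comm] using (isHomogeneous_X R p).mul (hq p))
    obtain ⟨U, hU⟩ := exists_koszul (W := fun p => q p - B p) (by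
      simp only [mul_sub, Finset.sum_sub_distrib, hqB, sub_self])
    have key : P = (P - ∑ p, C (a p) * q p) + ∑ p, C (a p) * B p
        + ∑ p, U p * rowForm a p := by
      have u0 := hU 0
      have u1 := hU 1
      have u2 := hU 2
      simp [Fin.sum_univ_three, rowForm] at u0 u1 u2 ⊢
      linear_combination C (a 0) * u0 + C (a 1) * u1 + C (a 2) * u2
    rw [key]
    exact add_mem (add_mem (rowIdeal_le_cons L a m2)
      (sum_mem fun p _ => Ideal.mul_mem_left _ _ (rowIdeal_le_cons L a (hB p))))
      (sum_mem fun p _ => Ideal.mul_mem_left _ _ (rowForm_mem List.mem_cons_self p))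

end StrandData
end TopDegree

section Existence

open MvPolynomial

namespace StrandData

/-- Iterating the extension by the rows in `L`, starting with the trivial complex. -/
lemma exists_of_rows {R : Type} [CommRing R] {I : Ideal R} {S : Set (Fin 3 → R)}
    (hS : ∀ a ∈ S, ∀ b ∈ S, ∀ p, a (p + 1) * b (p + 2) - a (p + 2) * b (p + 1) ∈ I)
    (L : List (Fin 3 → R)) (hL : ∀ a ∈ L, a ∈ S) :
    ∃ (V : Type) (_ : AddCommGroup V) (_ : Module R V) (X : StrandData R V),
      X.Good (2 * L.length) ∧ (∀ a ∈ L, ∀ p, X.NullHtpy (crossOp a X.y p)) ∧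
      X.Img I S L ∧ X.Top (2 * L.length) L.length L := by
  induction L with
  | nil =>
    exact ⟨_, _, _, base R, base_good, by simp, img_base I S, top_base⟩
  | cons a L ih =>
    obtain ⟨V, _, _, X, hX, hH, hI, hT⟩ := ih fun b hb => hL b (List.mem_cons_of_mem _ hb)
    have e : (2 * ((a :: L).length : ℤ)) = 2 * L.length + 2 := by
      rw [List.length_cons]; push_cast; ring
    refine ⟨_, _, _, X.step a, ?_, fun b hb p => ?_, hX.img_step hS hI (hL a List.mem_cons_self), ?_⟩
    · rw [e]
      exact hX.step a
    · rcases List.mem_cons.1 hb with rfl | hb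
      · exact hX.nullHtpy_step_new b p
      · exact (hH b hb p).step_old a
    · rw [e, List.length_cons]
      push_cast
      exact hX.top_step hT a

end StrandData

lemma minor_mem_minors {k : Type} [Field k] {n g : ℕ} (A : Matrix (Fin g) (Fin 3) (RR k n))
    (i j : Fin g) (p : Fin 3) :
    A i (p + 1) * A j (p + 2) - A i (p + 2) * A j (p + 1) ∈ minors A 2 := by
  by_cases hij : i = j
  · subst hij
    rw [mul_comm, sub_self]
    exact zero_mem _
  · refine Ideal.subset_span ⟨![i, j], ![p + 1, p + 2], ?_, ?_, ?_⟩
    · intro x y h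
      fin_cases x <;> fin_cases y <;> simp_all [Ne.symm hij]
    · intro x y h
      fin_cases p <;> fin_cases x <;> fin_cases y <;> simp_all
    · rw [Matrix.det_fin_two]
      simp

lemma minors_two_eq_span {k : Type} [Field k] {n g : ℕ} (A : Matrix (Fin g) (Fin 3) (RR k n)) :
    minors A 2 =
      Ideal.span {m | ∃ i j p, m = A i (p + 1) * A j (p + 2) - A i (p + 2) * A j (p + 1)} := by
  refine le_antisymm (Ideal.span_le.2 ?_) (Ideal.span_le.2 ?_)
  · rintro _ ⟨r, c, -, hc, rfl⟩
    rw [Matrix.det_fin_two]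
    simp only [Matrix.submatrix_apply]
    have h01 : c 0 ≠ c 1 := fun h => by simpa using hc h
    obtain ⟨p, hp⟩ : ∃ p, (c 0 = p + 1 ∧ c 1 = p + 2) ∨ (c 0 = p + 2 ∧ c 1 = p + 1) := by
      revert h01
      generalize c 0 = x
      generalize c 1 = y
      revert x y
      decide
    rcases hp with ⟨h0, h1⟩ | ⟨h0, h1⟩
    · rw [h0, h1]
      refine Ideal.subset_span ⟨r 0, r 1, p, ?_⟩
      ring
    · rw [h0, h1]
      refine Ideal.subset_span ⟨r 1, r 0, p, ?_⟩
      ring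
  · rintro _ ⟨i, j, p, rfl⟩
    exact minor_mem_minors A i j p

end Existence

section Acyclicity

open Abelian

variable {R : Type} [CommRing R]

/-- The vanishing of `Ext` below degree `d` for all finitely generated modules supported
on `V(I)`. -/
def ExtVanishing (I : Ideal R) (d : ℕ) (M : Type) [AddCommGroup M] [Module R M] : Prop :=
  ∀ (N : ModuleCat.{0} R), Module.Finite R N →
    Module.support R N ⊆ PrimeSpectrum.zeroLocus I →
    ∀ i < d, Subsingleton (Abelian.Ext N (ModuleCat.of R M) i)

variable {I : Ideal R} {d : ℕ} {M M' : Type} [AddCommGroup M] [Module R M] [AddCommGroup M']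
  [Module R M']

lemma ExtVanishing.mono (h : ExtVanishing I d M) {e : ℕ} (he : e ≤ d) : ExtVanishing I e M :=
  fun N hN hs i hi => h N hN hs i (hi.trans_le he)

lemma extVanishing_of_isRegular [IsNoetherianRing R] (hI : I ≠ ⊤) (rs : List R)
    (mem : ∀ r ∈ rs, r ∈ I) (reg : RingTheory.Sequence.IsRegular R rs) :
    ExtVanishing I rs.length R := fun N _ hs =>
  ModuleCat.subsingleton_ext_of_exists_isRegular I N hs (ModuleCat.of R R)
    (by simpa [lt_top_iff_ne_top] using hI) rs mem reg

lemma ExtVanishing.of_sum_comp (h : ExtVanishing I d M') {ι : Type} [Fintype ι]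
    (p : ι → M →ₗ[R] M') (q : ι → M' →ₗ[R] M) (hpq : ∀ x, ∑ j, q j (p j x) = x) :
    ExtVanishing I d M := fun N hN hs i hi => by
  have := h N hN hs i hi
  have hid : ∑ j, ModuleCat.ofHom (p j) ≫ ModuleCat.ofHom (q j) = 𝟙 (ModuleCat.of R M) := by
    ext x
    simpa [ModuleCat.hom_sum] using hpq x
  refine subsingleton_of_forall_eq 0 fun x => ?_
  rw [← Ext.comp_mk₀_id x, ← hid, Ext.mk₀_sum, Ext.comp_sum]
  refine Finset.sum_eq_zero fun j _ => ?_
  rw [← Ext.mk₀_comp_mk₀, ← Ext.comp_assoc_of_second_deg_zero,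
    Subsingleton.elim (x.comp (Ext.mk₀ (ModuleCat.ofHom (p j))) (add_zero i)) 0, Ext.zero_comp]

lemma extVanishing_of_dualBasis (h : ExtVanishing I d R) {ι : Type} [Fintype ι]
    (f : ι → M →ₗ[R] R) (e : ι → M) (hfe : ∀ x, x = ∑ j, f j x • e j) : ExtVanishing I d M :=
  h.of_sum_comp f (fun j => LinearMap.toSpanSingleton R M (e j)) fun x => by
    simpa using (hfe x).symm

lemma shortExact_ker_range (f : M →ₗ[R] M') :
    (ShortComplex.mk (ModuleCat.ofHom (LinearMap.ker f).subtype)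
      (ModuleCat.ofHom f.rangeRestrict) (by ext x; exact x.2)).ShortExact where
  exact := (ShortComplex.ShortExact.moduleCat_exact_iff_function_exact _).2 <|
    LinearMap.exact_iff.2 (by simp)
  mono_f := (ModuleCat.mono_iff_injective _).2 (LinearMap.ker f).subtype_injective
  epi_g := (ModuleCat.epi_iff_surjective _).2 f.surjective_rangeRestrict

lemma shortExact_mkQ (B : Submodule R M) :
    (ShortComplex.mk (ModuleCat.ofHom B.subtype) (ModuleCat.ofHom B.mkQ)
      (by ext x; simp)).ShortExact where
  exact := (ShortComplex.ShortExact.moduleCat_exact_iff_function_exact _).2 fun x => by simp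
  mono_f := (ModuleCat.mono_iff_injective _).2 B.subtype_injective
  epi_g := (ModuleCat.epi_iff_surjective _).2 B.mkQ_surjective

lemma ExtVanishing.range (f : M →ₗ[R] M') (h1 : ExtVanishing I d M)
    (h2 : ExtVanishing I (d + 1) (LinearMap.ker f)) : ExtVanishing I d (LinearMap.range f) :=
  fun N hN hs i hi => by
    have := h1 N hN hs i hi
    have := h2 N hN hs (i + 1) (by omega)
    refine subsingleton_of_forall_eq 0 fun x => ?_
    obtain ⟨y, rfl⟩ := Ext.covariant_sequence_exact₃ N (shortExact_ker_range f) x rfl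
      (Subsingleton.elim _ _)
    rw [Subsingleton.elim y 0, Ext.zero_comp]

lemma eq_of_extVanishing [IsNoetherianRing R] [Module.Finite R M] {s : Set R}
    (hs : I = Ideal.span s) {B Z : Submodule R M} (hBZ : B ≤ Z) (hB : ExtVanishing I 2 B)
    (hM : ExtVanishing I 1 M) {m : ℕ} (h : ∀ r ∈ s, ∀ z ∈ Z, r ^ m • z ∈ B) : Z = B := by
  let N : Submodule R (M ⧸ B) := Z.map B.mkQ
  have hsupp : Module.support R N ⊆ PrimeSpectrum.zeroLocus I := by
    rw [Module.support_eq_zeroLocus, hs, PrimeSpectrum.zeroLocus_span]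
    intro 𝔭 h𝔭 r hr
    refine 𝔭.2.mem_of_pow_mem m (h𝔭 (Module.mem_annihilator.2 ?_))
    rintro ⟨_, z, hz, rfl⟩
    ext
    simpa [← Submodule.Quotient.mk_smul] using h r hr z hz
  have h0 := hM (ModuleCat.of R N) inferInstance hsupp 0 one_pos
  have h1 := hB (ModuleCat.of R N) inferInstance hsupp 1 one_lt_two
  have h2 : Ext.mk₀ (ModuleCat.ofHom N.subtype) = 0 := by
    obtain ⟨y, hy⟩ := Ext.covariant_sequence_exact₃ (ModuleCat.of R N) (shortExact_mkQ B)
      (Ext.mk₀ (ModuleCat.ofHom N.subtype)) rfl (Subsingleton.elim _ _)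
    rw [← hy, Subsingleton.elim y 0, Ext.zero_comp]
  rw [Ext.mk₀_eq_zero_iff] at h2
  refine le_antisymm (fun z hz => ?_) hBZ
  have := ConcreteCategory.congr_hom h2 ⟨B.mkQ z, Submodule.mem_map_of_mem hz⟩
  simpa using this

end Acyclicity

section Resolution

open Limits

/-- An exact augmented complex of projectives is a projective resolution. -/
def projectiveResolutionOfExact {C : Type*} [Category* C] [Abelian C] {Z : C}
    (K : ChainComplex C ℕ) (hK : ∀ n, Projective (K.X n)) (π : K.X 0 ⟶ Z)
    (w : K.d 1 0 ≫ π = 0) (h0 : (ShortComplex.mk _ _ w).Exact) (hπ : Epi π)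
    (h : ∀ n, K.ExactAt (n + 1)) : ProjectiveResolution Z where
  complex := K
  projective := hK
  π := (K.toSingle₀Equiv Z).symm ⟨π, w⟩
  quasiIso := ⟨fun n => by
    cases n with
    | zero =>
      rw [ChainComplex.quasiIsoAt₀_iff, ShortComplex.quasiIso_iff_of_zeros']
      · refine (ShortComplex.exact_and_epi_g_iff_of_iso ?_).2 ⟨h0, hπ⟩
        refine ShortComplex.isoMk (Iso.refl _) (Iso.refl _) (Iso.refl _) ?_ ?_
        · exact (Category.id_comp _).trans (Category.comp_id _).symm
        · refine (Category.id_comp _).trans (Eq.trans ?_ (Category.comp_id _).symm)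
          exact (ChainComplex.toSingle₀Equiv_symm_apply_f_zero π w).symm
      · exact K.shape _ _ (by simp)
      · rfl
      · rfl
    | succ n =>
      rw [quasiIsoAt_iff_exactAt' (hL := ChainComplex.exactAt_succ_single_obj ..)]
      exact h n⟩

variable {R : Type} [CommRing R]

/-- If `P` is a projective resolution of `Z` with `P_{j + 2} = 0`, then `Ext^{j + 1}(Z, Y)` is the
cokernel of `Hom(P_j, Y) → Hom(P_{j + 1}, Y)`: any surjection from `Hom(P_{j + 1}, Y)` with the
appropriate kernel computes `Ext`. -/
lemma nonempty_ext_iso {Z Y : ModuleCat.{0} R} (P : ProjectiveResolution Z) (j : ℕ)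
    (hP : IsZero (P.complex.X (j + 2))) {N : Type} [AddCommGroup N] [Module R N]
    (f : (P.complex.X (j + 1) ⟶ Y) →ₗ[R] N) (hf : Function.Surjective f)
    (hker : ∀ φ, f φ = 0 ↔ ∃ ψ : P.complex.X j ⟶ Y, P.complex.d (j + 1) j ≫ ψ = φ) :
    Nonempty (((Ext R (ModuleCat.{0} R) (j + 1)).obj (Opposite.op Z)).obj Y ≅ ModuleCat.of R N) := by
  let K := P.complex.linearYonedaObj R Y
  let S := ShortComplex.mk (K.d j (j + 1)) (ModuleCat.ofHom f) (by
    ext ψ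
    exact (hker _).2 ⟨ψ, rfl⟩)
  have hS : S.Exact := (ShortComplex.moduleCat_exact_iff _).2 fun φ hφ => (hker φ).1 hφ
  have : Epi S.g := (ModuleCat.epi_iff_surjective _).2 hf
  have hg : (K.sc' j (j + 1) (j + 2)).g = 0 := by
    ext φ
    exact hP.eq_of_src _ _
  exact ⟨P.isoExt (j + 1) Y ≪≫ K.homologyIsoSc' j (j + 1) (j + 2) (by simp) (by simp) ≪≫
    (ShortComplex.LeftHomologyData.ofIsColimitCokernelCofork (K.sc' j (j + 1) (j + 2)) hg
      (CokernelCofork.ofπ (f := (K.sc' j (j + 1) (j + 2)).f) S.g S.zero) hS.gIsCokernel).homologyIso⟩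

end Resolution

section Acyclic

variable {R : Type} [CommRing R] {I : Ideal R} {c : ℕ}

/-- The acyclicity lemma: a complex of length `c` of modules of depth at least `c`, with homology
killed by powers of the generators of `I`, is acyclic. -/
lemma ker_eq_range_of_extVanishing [IsNoetherianRing R] {s : Set R} (hs : I = Ideal.span s)
    {F : ℕ → ModuleCat.{0} R} (d : ∀ i, F (i + 1) →ₗ[R] F i)
    (hdd : ∀ i x, d i (d (i + 1) x) = 0) [∀ i, Module.Finite R (F i)]
    (hF : ∀ i, ExtVanishing I c (F i)) (h0 : ∀ i, c < i → Subsingleton (F i)) {m : ℕ}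
    (ht : ∀ i, ∀ r ∈ s, ∀ z, d i z = 0 → ∃ w, d (i + 1) w = r ^ m • z) (i : ℕ) :
    LinearMap.ker (d i) = LinearMap.range (d (i + 1)) := by
  have hle : ∀ i, LinearMap.range (d (i + 1)) ≤ LinearMap.ker (d i) := by
    rintro i _ ⟨x, rfl⟩
    exact hdd i x
  have key : ∀ i < c, ExtVanishing I (i + 2) (LinearMap.range (d (i + 1))) →
      LinearMap.ker (d i) = LinearMap.range (d (i + 1)) := fun i hi h =>
    (eq_of_extVanishing hs (hle i) (h.mono (by omega)) ((hF _).mono (by omega)) (m := m)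
      fun r hr z hz => ht i r hr z hz)
  have hr : ∀ j, j ≤ c → ExtVanishing I (c - j + 1) (LinearMap.range (d (c - j))) := by
    intro j
    induction j with
    | zero =>
      intro _
      have := h0 (c + 1) (by omega)
      rw [Nat.sub_zero]
      have : Subsingleton (LinearMap.range (d c)) := by
        refine ⟨?_⟩
        rintro ⟨_, x, rfl⟩ ⟨_, y, rfl⟩
        rw [Subsingleton.elim x y]
      intro N _ _ i _
      have hz : Limits.IsZero (ModuleCat.of R (LinearMap.range (d c))) :=
        ModuleCat.isZero_of_subsingleton _
      refine subsingleton_of_forall_eq 0 fun x => ?_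
      rw [← Abelian.Ext.comp_mk₀_id x, hz.eq_of_src (𝟙 _) 0, Abelian.Ext.mk₀_zero,
        Abelian.Ext.comp_zero]
    | succ j ih =>
      intro hj
      have h := ih (by omega)
      obtain ⟨i, hi⟩ : ∃ i, i = c - (j + 1) := ⟨_, rfl⟩
      rw [show c - j = i + 1 by omega] at h
      rw [← hi]
      have hk := key i (by omega) h
      refine ExtVanishing.range (d i) ((hF _).mono (by omega)) ?_
      rw [hk]
      exact h
  rcases lt_or_ge i c with hi | hi
  · refine key i hi ?_
    have := hr (c - (i + 1)) (by omega)
    rwa [show c - (c - (i + 1)) = i + 1 by omega] at this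
  · have := h0 (i + 1) (by omega)
    refine le_antisymm (fun x _ => ?_) (hle i)
    rw [Subsingleton.elim x 0]
    exact zero_mem _

end Acyclic

namespace StrandData

variable {R V : Type} [CommRing R] [AddCommGroup V] [Module R V] {X : StrandData R V} {t : ℤ}

/-- The terms of the augmented strand in degree `3`. -/
def strandObj (X : StrandData R V) : ℕ → ModuleCat.{0} R
  | 0 => ModuleCat.of R R
  | i + 1 => ModuleCat.of R (X.gr ((i : ℤ) + 3) 3)

/-- The differentials of the augmented strand in degree `3`. -/
def strandD (hX : X.Good t) : ∀ i, X.strandObj (i + 1) →ₗ[R] X.strandObj i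
  | 0 => X.E3 ∘ₗ (X.gr (((0 : ℕ) : ℤ) + 3) 3).subtype
  | i + 1 => X.D.restrict (p := X.gr (((i + 1 : ℕ) : ℤ) + 3) 3) (q := X.gr ((i : ℤ) + 3) 3)
      fun v hv => by
        have := hX.gr_D hv
        rwa [show (((i + 1 : ℕ) : ℤ) + 3 - 1) = (i : ℤ) + 3 by push_cast; ring] at this

lemma strandD_strandD (hX : X.Good t) (i : ℕ) (v : X.strandObj (i + 2)) :
    strandD hX i (strandD hX (i + 1) v) = 0 := by
  cases i with
  | zero => exact hX.E3_D (v := v.1) v.2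
  | succ i => exact Subtype.ext (hX.D_D v.1)

lemma Good.gr_dualBasis (hX : X.Good t) (i δ : ℤ) :
    ∃ (ι : Type) (_ : Fintype ι) (f : ι → X.gr i δ →ₗ[R] R) (e : ι → X.gr i δ),
      ∀ v, v = ∑ j, f j v • e j := by
  obtain ⟨ι, _, f, e, he, h⟩ := hX.dualBasis i δ
  refine ⟨ι, inferInstance, fun j => f j ∘ₗ Submodule.subtype _, fun j => ⟨e j, he j⟩, fun v => ?_⟩
  ext
  simpa using h v v.2

lemma Good.strandObj_dualBasis (hX : X.Good t) (i : ℕ) :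
    ∃ (ι : Type) (_ : Fintype ι) (f : ι → X.strandObj i →ₗ[R] R) (e : ι → X.strandObj i),
      ∀ v, v = ∑ j, f j v • e j := by
  cases i with
  | zero => exact ⟨Unit, inferInstance, fun _ => (LinearMap.id : R →ₗ[R] R), fun _ => (1 : R),
      fun v => by
        rw [Finset.univ_unique, Finset.sum_singleton]
        exact (mul_one (show R from v)).symm⟩
  | succ i => exact hX.gr_dualBasis _ _

end StrandData

section DualBasis

variable {R M : Type} [CommRing R] [AddCommGroup M] [Module R M] {ι : Type} [Fintype ι]

lemma finite_of_dualBasis (f : ι → M →ₗ[R] R) (e : ι → M) (hfe : ∀ x, x = ∑ j, f j x • e j) :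
    Module.Finite R M := 
  .of_surjective (Fintype.linearCombination R e) fun x => ⟨fun j => f j x, by
    rw [Fintype.linearCombination_apply, ← hfe]⟩

lemma projective_of_dualBasis (f : ι → M →ₗ[R] R) (e : ι → M)
    (hfe : ∀ x, x = ∑ j, f j x • e j) : Module.Projective R M :=
  .of_split (LinearMap.pi f) (Fintype.linearCombination R e) <| by
    ext x
    simpa [Fintype.linearCombination_apply] using (hfe x).symm

end DualBasis

namespace StrandData

variable {R V : Type} [CommRing R] [AddCommGroup V] [Module R V] {X : StrandData R V} {t : ℤ}

/-- The differentials of the augmented strand, as morphisms. -/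
def strandHom (hX : X.Good t) (i : ℕ) : X.strandObj (i + 1) ⟶ X.strandObj i :=
  ModuleCat.ofHom (strandD hX i)

/-- The augmented strand in degree `3`, as a chain complex. -/
def strandComplex (hX : X.Good t) : ChainComplex (ModuleCat.{0} R) ℕ :=
  ChainComplex.of X.strandObj (strandHom hX) fun i => by
    ext v
    exact strandD_strandD hX i v

lemma strandComplex_d (hX : X.Good t) (i : ℕ) :
    (strandComplex hX).d (i + 1) i = strandHom hX i :=
  ChainComplex.of_d X.strandObj (strandHom hX) i

lemma strandComplex_d_apply (hX : X.Good t) (i : ℕ) (v : X.strandObj (i + 1)) :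
    (strandComplex hX).d (i + 1) i v = strandD hX i v :=
  ConcreteCategory.congr_hom (strandComplex_d hX i) v

lemma Good.ker_strandD [IsNoetherianRing R] (hX : X.Good t) {c : ℕ} (hc : t = c + 2) {s : Set R}
    {I : Ideal R} (hs : I = Ideal.span s) (hI : ExtVanishing I c R)
    (hH : ∀ r ∈ s, ∀ m, X.NullHtpy (r • X.y m)) (i : ℕ) :
    LinearMap.ker (strandD hX i) = LinearMap.range (strandD hX (i + 1)) := by
  have : ∀ i, Module.Finite R (X.strandObj i) := fun i => by
    obtain ⟨ι, _, f, e, h⟩ := hX.strandObj_dualBasis i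
    exact finite_of_dualBasis f e h
  refine ker_eq_range_of_extVanishing hs (strandD hX) (strandD_strandD hX) (c := c) (m := 3)
    (fun i => ?_) (fun i hi => ?_) (fun i r hr z hz => ?_) i
  · obtain ⟨ι, _, f, e, h⟩ := hX.strandObj_dualBasis i
    exact extVanishing_of_dualBasis hI f e h
  · cases i with
    | zero => omega
    | succ i =>
      have h0 : ∀ v : X.gr ((i : ℤ) + 3) 3, v = 0 := fun v =>
        Subtype.ext (hX.gr_top (by rw [hc]; omega) v.2)
      exact ⟨fun v w => (h0 v).trans (h0 w).symm⟩
  · have hz' : X.D z.1 = 0 ∧ ((i : ℤ) + 3 ≠ 3 ∨ X.E3 z.1 = 0) := by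
      cases i with
      | zero => exact ⟨hX.gr_lt (i := 3 - 1) (δ := 3) (by norm_num)
          (hX.gr_D (i := 3) (by simpa using z.2)), .inr hz⟩
      | succ i => exact ⟨congr_arg Subtype.val hz, .inl (by push_cast; omega)⟩
    obtain ⟨w, hw, h⟩ := hX.torsion (hH r hr) (z := z.1) z.2 hz'.1 hz'.2
    refine ⟨⟨w, ?_⟩, Subtype.ext h⟩
    rwa [show (((i + 1 : ℕ) : ℤ) + 3) = (i : ℤ) + 3 + 1 by push_cast; ring]

lemma Good.nonempty_ext_iso [IsNoetherianRing R] (hX : X.Good t) {c : ℕ} (hc : t = c + 1 + 1 + 2)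
    {s : Set R} {I : Ideal R} (hs : I = Ideal.span s) (hI : ExtVanishing I (c + 1 + 1) R)
    (hH : ∀ r ∈ s, ∀ m, X.NullHtpy (r • X.y m))
    (hE : LinearMap.range (strandD hX 0) = I) {N : Type} [AddCommGroup N] [Module R N]
    (f : (X.gr (((c + 1 : ℕ) : ℤ) + 3) 3 →ₗ[R] R) →ₗ[R] N) (hf : Function.Surjective f)
    (hker : ∀ φ, f φ = 0 ↔ ∃ ψ : V →ₗ[R] R, ∀ v, φ v = ψ (X.D (v : V))) :
    Nonempty (ExtM R (c + 1 + 1) (R ⧸ I) R ≅ ModuleCat.of R N) := by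
  have hk := fun i => hX.ker_strandD (c := c + 1 + 1) (by rw [hc]; push_cast; ring) hs hI hH i
  let P : ProjectiveResolution (ModuleCat.of R (R ⧸ I)) :=
    projectiveResolutionOfExact (strandComplex hX)
      (fun i => by
        obtain ⟨ι, _, f, e, h⟩ := hX.strandObj_dualBasis i
        rw [← IsProjective.iff_projective]
        exact projective_of_dualBasis f e h)
      (ModuleCat.ofHom (Submodule.mkQ I))
      (by
        ext v
        refine (Submodule.Quotient.mk_eq_zero I).2 ?_
        rw [← hE]
        exact ⟨v, (strandComplex_d_apply hX 0 v).symm⟩)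
      (by
        rw [ShortComplex.moduleCat_exact_iff]
        intro r hr
        have : (show R from r) ∈ I := (Submodule.Quotient.mk_eq_zero I).1 hr
        rw [← hE] at this
        obtain ⟨v, hv⟩ := this
        exact ⟨v, (strandComplex_d_apply hX 0 v).trans hv⟩)
      ((ModuleCat.epi_iff_surjective _).2 (Submodule.mkQ_surjective I))
      (fun i => by
        rw [HomologicalComplex.exactAt_iff' _ (i + 2) (i + 1) i (by simp) (by simp),
          ShortComplex.moduleCat_exact_iff]
        intro v hv
        have : v ∈ LinearMap.ker (strandD hX i) :=
          (strandComplex_d_apply hX i v).symm.trans hv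
        rw [hk i] at this
        obtain ⟨w, hw⟩ := this
        exact ⟨w, (strandComplex_d_apply hX (i + 1) w).trans hw⟩)
  have hz : Limits.IsZero (P.complex.X (c + 2 + 1)) := by
    have h0 : ∀ v : X.gr (((c + 2 : ℕ) : ℤ) + 3) 3, v = 0 := fun v =>
      Subtype.ext (hX.gr_top (by rw [hc]; push_cast; omega) v.2)
    have : Subsingleton (P.complex.X (c + 2 + 1)) := ⟨fun v w => (h0 v).trans (h0 w).symm⟩
    exact ModuleCat.isZero_of_subsingleton _
  let e : (P.complex.X (c + 1 + 1) ⟶ ModuleCat.of R R) ≃ₗ[R]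
      (X.gr (((c + 1 : ℕ) : ℤ) + 3) 3 →ₗ[R] R) := ModuleCat.homLinearEquiv
  refine KMR.nonempty_ext_iso P (c + 1) hz (f ∘ₗ e.toLinearMap)
    (hf.comp e.surjective) fun φ => ?_
  have hd : P.complex.d (c + 1 + 1) (c + 1) = ModuleCat.ofHom (strandD hX (c + 1)) :=
    strandComplex_d hX (c + 1)
  have h1 : (f ∘ₗ e.toLinearMap) φ = f (e φ) := rfl
  rw [h1, hker, hd]
  constructor
  · rintro ⟨ψ, hψ⟩
    refine ⟨ModuleCat.ofHom (ψ ∘ₗ (X.gr ((c : ℤ) + 3) 3).subtype), ?_⟩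
    ext v
    exact (hψ v).symm
  · rintro ⟨ψ, hψ⟩
    obtain ⟨ι, _, g, b, hb, h⟩ := hX.dualBasis ((c : ℤ) + 3) 3
    have hψ' : ∃ ψ' : X.gr ((c : ℤ) + 3) 3 →ₗ[R] R, ψ' = ψ.hom := ⟨ψ.hom, rfl⟩
    obtain ⟨ψ', hψ'⟩ := hψ'
    refine ⟨∑ j, (ψ' ⟨b j, hb j⟩) • g j, fun v => ?_⟩
    have h2 : e φ v = ψ' (strandD hX (c + 1) v) := by
      rw [← hψ, hψ']
      rfl
    have hv : X.D (v : V) ∈ X.gr ((c : ℤ) + 3) 3 :=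
      (show X.gr ((c : ℤ) + 3) 3 from strandD hX (c + 1) v).2
    have h3 : (⟨X.D v, hv⟩ : X.gr ((c : ℤ) + 3) 3) = ∑ j, g j (X.D (v : V)) • ⟨b j, hb j⟩ := by
      ext
      rw [AddSubmonoidClass.coe_finsetSum]
      exact h _ hv
    refine (h2.trans (congr_arg ψ' h3)).trans ?_
    rw [map_sum, LinearMap.sum_apply]
    refine Finset.sum_congr rfl fun j _ => ?_
    rw [map_smul, LinearMap.smul_apply, smul_eq_mul, smul_eq_mul, mul_comm]

end StrandData

section SymSquare

variable {R N : Type} [CommRing R] [AddCommGroup N] [Module R N]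

/-- The class of `x ⊗ y` in the second symmetric power. -/
def symMk (x y : N) : SymPow R N 2 := Submodule.Quotient.mk (PiTensorProduct.tprod R ![x, y])

lemma symMk_comm (x y : N) : symMk (R := R) x y = symMk y x := by
  refine (Submodule.Quotient.eq _).2 (Submodule.subset_span ⟨Equiv.swap 0 1, ![x, y], ?_⟩)
  congr 2
  ext i
  fin_cases i <;> simp

/-- The symmetric product `N × N → S₂ N`. -/
def symMul (R N : Type) [CommRing R] [AddCommGroup N] [Module R N] : N →ₗ[R] N →ₗ[R] SymPow R N 2 :=
  have h1 : ∀ x x' y : N, symMk (R := R) (x + x') y = symMk x y + symMk x' y := fun x x' y =>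
    (congr_arg Submodule.Quotient.mk
      ((PiTensorProduct.tprod R (s := fun _ : Fin 2 => N)).cons_add ![y] x x')).trans
      (Submodule.Quotient.mk_add _)
  have h2 : ∀ (c : R) (x y : N), symMk (R := R) (c • x) y = c • symMk x y := fun c x y =>
    (congr_arg Submodule.Quotient.mk 
      ((PiTensorProduct.tprod R (s := fun _ : Fin 2 => N)).cons_smul ![y] c x)).trans
      (Submodule.Quotient.mk_smul _ _ _)
  LinearMap.mk₂ R symMk h1 h2
    (fun x y y' => by rw [symMk_comm, h1, symMk_comm y, symMk_comm y'])
    (fun c x y => by rw [symMk_comm, h2, symMk_comm y])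

lemma symMul_apply (x y : N) : symMul R N x y = symMk x y := rfl

lemma symMul_comm (x y : N) : symMul R N x y = symMul R N y x := symMk_comm x y

lemma span_symMul : Submodule.span R {z | ∃ x y, z = symMul R N x y} = ⊤ := by
  refine eq_top_iff.2 fun z _ => ?_
  obtain ⟨z, rfl⟩ := Submodule.Quotient.mk_surjective _ z
  induction z using PiTensorProduct.induction_on with
  | smul_tprod r f =>
    have hf : f = ![f 0, f 1] := by
      ext i
      fin_cases i <;> rfl
    rw [hf]
    exact Submodule.smul_mem _ r
      (Submodule.subset_span (s := {z | ∃ x y, z = symMul R N x y}) ⟨f 0, f 1, rfl⟩)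
  | add x y hx hy => exact add_mem (hx trivial) (hy trivial)

/-- The map out of `S₂ N` induced by a linear map from `N` to a commutative algebra. -/
def symLift {B : Type} [CommRing B] [Algebra R B] (l : N →ₗ[R] B) : SymPow R N 2 →ₗ[R] B :=
  Submodule.liftQ _
    (PiTensorProduct.lift ((MultilinearMap.mkPiAlgebra R (Fin 2) B).compLinearMap fun _ => l)) <| by
    refine Submodule.span_le.2 ?_
    rintro _ ⟨σ, f, rfl⟩
    simp only [SetLike.mem_coe, LinearMap.mem_ker, map_sub, PiTensorProduct.lift.tprod,
      MultilinearMap.compLinearMap_apply, MultilinearMap.mkPiAlgebra_apply, Function.comp_apply]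
    rw [Equiv.prod_comp σ fun i => l (f i), sub_self]

lemma symLift_symMul {B : Type} [CommRing B] [Algebra R B] (l : N →ₗ[R] B) (x y : N) :
    symLift l (symMul R N x y) = l x * l y := by
  rw [symMul_apply, symMk, symLift, Submodule.liftQ_apply, PiTensorProduct.lift.tprod]
  simp

end SymSquare

section Wedge

variable {R M : Type} [CommRing R] [AddCommGroup M] [Module R M]

/-- The wedge product `M × M → ⋀² M`. -/
def wedge (x y : M) : ⋀[R]^2 M := exteriorPower.ιMulti R 2 ![x, y]

/-- The map out of `⋀² M` induced by an alternating bilinear map. -/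
def wedgeLift {B : Type} [AddCommGroup B] [Module R B] (b : M →ₗ[R] M →ₗ[R] B)
    (hb : ∀ x, b x x = 0) : ⋀[R]^2 M →ₗ[R] B :=
  exteriorPower.alternatingMapLinearEquiv
    { toFun := fun v => b (v 0) (v 1)
      map_update_add' := fun v i x y => by
        fin_cases i <;> simp
      map_update_smul' := fun v i c x => by
        fin_cases i <;> simp
      map_eq_zero_of_eq' := fun v i j h hij => by
        have : v 0 = v 1 := by
          fin_cases i <;> fin_cases j <;> simp_all
        rw [this, hb] }

lemma wedgeLift_wedge {B : Type} [AddCommGroup B] [Module R B] (b : M →ₗ[R] M →ₗ[R] B)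
    (hb : ∀ x, b x x = 0) (x y : M) : wedgeLift b hb (wedge x y) = b x y := by
  rw [wedgeLift, wedge, exteriorPower.alternatingMapLinearEquiv_apply_ιMulti]
  rfl

lemma span_wedge : Submodule.span R {z | ∃ x y : M, z = wedge (R := R) x y} = ⊤ := by
  rw [← exteriorPower.ιMulti_span R 2 M]
  congr 1
  ext z
  constructor
  · rintro ⟨x, y, rfl⟩
    exact ⟨_, rfl⟩
  · rintro ⟨f, rfl⟩
    refine ⟨f 0, f 1, congr_arg _ ?_⟩
    ext i
    fin_cases i <;> rfl

lemma wedge_self (x : M) : wedge (R := R) x x = 0 :=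
  (exteriorPower.ιMulti R 2).map_eq_zero_of_eq _ (i := 0) (j := 1) rfl (by decide)

lemma wedge_add_left (x x' y : M) : wedge (R := R) (x + x') y = wedge x y + wedge x' y :=
  (exteriorPower.ιMulti R 2).toMultilinearMap.cons_add ![y] x x'

lemma wedge_smul_left (c : R) (x y : M) : wedge (R := R) (c • x) y = c • wedge x y :=
  (exteriorPower.ιMulti R 2).toMultilinearMap.cons_smul ![y] c x

lemma wedge_neg_swap (x y : M) : wedge (R := R) x y = - wedge y x := by
  have h := (exteriorPower.ιMulti R 2).map_swap ![y, x] (i := 0) (j := 1) (by decide)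
  rw [wedge, wedge, ← h]
  congr 1
  ext i
  fin_cases i <;> simp

lemma wedge_add_right (x y y' : M) : wedge (R := R) x (y + y') = wedge x y + wedge x y' := by
  rw [wedge_neg_swap, wedge_add_left, neg_add, ← wedge_neg_swap, ← wedge_neg_swap]

lemma wedge_smul_right (c : R) (x y : M) : wedge (R := R) x (c • y) = c • wedge x y := by
  rw [wedge_neg_swap, wedge_smul_left, wedge_neg_swap x, smul_neg]

end Wedge

section SymPoly

open MvPolynomial

variable {R N : Type} [CommRing R] [AddCommGroup N] [Module R N]

open scoped Classical in
/-- The value of `polySym` on monomials. -/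
def monSym (b : Fin 3 → N) (s : Fin 3 →₀ ℕ) : SymPow R N 2 :=
  if h : ∃ x : Fin 3 × Fin 3, s = Finsupp.single x.1 1 + Finsupp.single x.2 1 then
    symMul R N (b h.choose.1) (b h.choose.2) else 0

lemma monSym_single_add_single (b : Fin 3 → N) (p q : Fin 3) :
    monSym (R := R) b (Finsupp.single p 1 + Finsupp.single q 1) = symMul R N (b p) (b q) := by
  have h : ∃ x : Fin 3 × Fin 3, Finsupp.single p 1 + Finsupp.single q 1 =
      Finsupp.single x.1 1 + Finsupp.single x.2 1 := ⟨(p, q), rfl⟩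
  rw [monSym, dif_pos h]
  have hs := h.choose_spec
  generalize h.choose = x at hs
  have hs' : (p = x.1 ∧ q = x.2) ∨ (p = x.2 ∧ q = x.1) := by
    have := (Finsupp.single_add_single_eq_single_add_single one_ne_zero one_ne_zero).1 hs
    grind
  rcases hs' with ⟨rfl, rfl⟩ | ⟨rfl, rfl⟩
  · rfl
  · exact symMul_comm _ _

/-- The linear map from polynomials to `S₂ N` sending `X_p X_q` to `b_p b_q`, and killing
the homogeneous components of degree different from `2`. -/
def polySym (b : Fin 3 → N) : MvPolynomial (Fin 3) R →ₗ[R] SymPow R N 2 :=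
  (basisMonomials (Fin 3) R).constr R (monSym b)

lemma polySym_monomial (b : Fin 3 → N) (s : Fin 3 →₀ ℕ) (r : R) :
    polySym b (monomial s r) = r • monSym b s := by
  have h : monomial s r = r • basisMonomials (Fin 3) R s := by
    rw [coe_basisMonomials, smul_monomial, smul_eq_mul, mul_one]
  rw [h, map_smul, polySym, Module.Basis.constr_basis]

lemma polySym_X_mul_X (b : Fin 3 → N) (p q : Fin 3) :
    polySym (R := R) b (X p * X q) = symMul R N (b p) (b q) := by
  rw [X, X, monomial_mul, mul_one, polySym_monomial, one_smul, monSym_single_add_single]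

lemma polySym_C_mul (b : Fin 3 → N) (r : R) (P : MvPolynomial (Fin 3) R) :
    polySym b (C r * P) = r • polySym b P := by
  rw [← smul_eq_C_mul, map_smul]

lemma polySym_monomial_mul_X (b : Fin 3 → N) {s : Fin 3 →₀ ℕ}
    (hs : ∀ q, s ≠ Finsupp.single q 1) (r : R) (p : Fin 3) :
    polySym b (monomial s r * X p) = 0 := by
  rw [X, monomial_mul, polySym_monomial, monSym, dif_neg, smul_zero]
  rintro ⟨⟨x, y⟩, h⟩
  have hp : p = x ∨ p = y := by
    by_contra! hp
    have := DFunLike.congr_fun h p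
    simp [Ne.symm hp.1, Ne.symm hp.2] at this
  rcases hp with rfl | rfl
  · exact hs y (add_right_cancel (h.trans (add_comm _ _)))
  · exact hs x (add_right_cancel h)

lemma polySym_mul_rowForm (b : Fin 3 → N) (a : Fin 3 → R) (p : Fin 3)
    (h : a (p + 1) • b (p + 2) = a (p + 2) • b (p + 1)) (U : MvPolynomial (Fin 3) R) :
    polySym b (U * rowForm a p) = 0 := by
  have key : ∀ (s : Fin 3 →₀ ℕ) (r : R), polySym b (monomial s r * rowForm a p) = 0 := by
    intro s r
    have e : monomial s r * rowForm a p = C (a (p + 1)) * (monomial s r * X (p + 2)) -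
        C (a (p + 2)) * (monomial s r * X (p + 1)) := by
      rw [rowForm]
      ring
    rw [e, map_sub, polySym_C_mul, polySym_C_mul]
    by_cases hs : ∃ q, s = Finsupp.single q 1
    · obtain ⟨q, rfl⟩ := hs
      have e' : monomial (Finsupp.single q 1) r = C r * X q := by rw [C_mul_X_eq_monomial]
      rw [e', mul_assoc, mul_assoc, polySym_C_mul, polySym_C_mul, polySym_X_mul_X,
        polySym_X_mul_X, smul_comm, ← map_smul, h, map_smul, smul_comm, sub_self]
    · push Not at hs
      rw [polySym_monomial_mul_X b hs, polySym_monomial_mul_X b hs, smul_zero, smul_zero, sub_self]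
  induction U using MvPolynomial.induction_on' with
  | monomial s r => exact key s r
  | add P Q hP hQ => rw [add_mul, map_add, hP, hQ, add_zero]

lemma polySym_eq_zero (b : Fin 3 → N) {L : List (Fin 3 → R)}
    (h : ∀ a ∈ L, ∀ p, a (p + 1) • b (p + 2) = a (p + 2) • b (p + 1))
    {P : MvPolynomial (Fin 3) R} (hP : P ∈ rowIdeal L) : polySym b P = 0 := by
  induction hP using Submodule.closure_induction with
  | zero => exact map_zero _
  | add P Q _ _ hP hQ => rw [map_add, hP, hQ, add_zero]
  | smul_mem U x hx =>
    obtain ⟨a, ha, p, rfl⟩ := hx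
    exact polySym_mul_rowForm b a p (h a ha p) U

lemma IsHomogeneous.exists_sum_X_mul_X {P : MvPolynomial (Fin 3) R} (hP : P.IsHomogeneous 2) :
    ∃ c : Fin 3 → Fin 3 → R, P = ∑ p, ∑ q, C (c p q) * (X p * X q) := by
  obtain ⟨g, hg, rfl⟩ := IsHomogeneous.exists_sum_X_mul (e := 1) hP
  choose g' hg' h using fun p => IsHomogeneous.exists_sum_X_mul (e := 0) (hg p)
  refine ⟨fun p q => coeff 0 (g' p q), Finset.sum_congr rfl fun p _ => ?_⟩
  rw [h p, Finset.mul_sum]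
  refine Finset.sum_congr rfl fun q _ => ?_
  have := totalDegree_eq_zero_iff_eq_C.1 (Nat.le_zero.1 (hg' p q).totalDegree_le)
  conv_lhs => rw [this]
  ring

lemma symLift_polySym {B : Type} [CommRing B] [Algebra R B] (b : Fin 3 → N) (l : N →ₗ[R] B)
    (f : MvPolynomial (Fin 3) R →ₐ[R] B) (h : ∀ p, l (b p) = f (X p))
    {P : MvPolynomial (Fin 3) R} (hP : P.IsHomogeneous 2) : symLift l (polySym b P) = f P := by
  obtain ⟨c, rfl⟩ := IsHomogeneous.exists_sum_X_mul_X hP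
  simp only [map_sum, polySym_C_mul, polySym_X_mul_X, map_smul, symLift_symMul, h, map_mul]
  refine Finset.sum_congr rfl fun p _ => Finset.sum_congr rfl fun q _ => ?_
  rw [← algebraMap_eq, AlgHom.commutes, Algebra.smul_def]

lemma exists_polySym_eq (b : Fin 3 → N) (h : Submodule.span R (Set.range b) = ⊤)
    (z : SymPow R N 2) : ∃ P : MvPolynomial (Fin 3) R, P.IsHomogeneous 2 ∧ polySym b P = z := by
  have hz : z ∈ Submodule.span R {z | ∃ x y, z = symMul R N x y} := by
    rw [span_symMul]
    trivial
  induction hz using Submodule.span_induction with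
  | mem z hz =>
    obtain ⟨x, y, rfl⟩ := hz
    have hs : ∀ x : N, ∃ c : Fin 3 → R, ∑ p, c p • b p = x := fun x =>
      (Submodule.mem_span_range_iff_exists_fun R).1 (h ▸ trivial)
    obtain ⟨c, rfl⟩ := hs x
    obtain ⟨d, rfl⟩ := hs y
    refine ⟨∑ p, ∑ q, C (c p * d q) * (X p * X q),
      IsHomogeneous.sum _ _ _ fun p _ => IsHomogeneous.sum _ _ _ fun q _ => ?_, ?_⟩
    · simpa using (isHomogeneous_C (Fin 3) (c p * d q)).mul
        ((isHomogeneous_X R p).mul (isHomogeneous_X R q))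
    · simp only [map_sum, polySym_C_mul, polySym_X_mul_X, map_smul, LinearMap.sum_apply,
        LinearMap.smul_apply, Finset.smul_sum, mul_smul]
      rw [Finset.sum_comm]
      refine Finset.sum_congr rfl fun p _ => Finset.sum_congr rfl fun q _ => ?_
      rw [smul_comm]
  | zero => exact ⟨0, isHomogeneous_zero _ _ _, map_zero _⟩
  | add z w _ _ hz hw =>
    obtain ⟨P, hP, rfl⟩ := hz
    obtain ⟨Q, hQ, rfl⟩ := hw
    exact ⟨P + Q, hP.add hQ, map_add _ _ _⟩
  | smul r z _ hz =>
    obtain ⟨P, hP, rfl⟩ := hz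
    exact ⟨r • P, Submodule.smul_mem (homogeneousSubmodule (Fin 3) R 2) r hP, map_smul _ _ _⟩

end SymPoly

section Cokernel

open MvPolynomial

variable {R : Type} [CommRing R]

/-- The linear form `(a × u) · X`. -/
def crossForm (R : Type) [CommRing R] :
    (Fin 3 → R) →ₗ[R] (Fin 3 → R) →ₗ[R] MvPolynomial (Fin 3) R :=
  LinearMap.mk₂ R (fun a u => - ∑ p, C (u p) * rowForm a p)
    (fun a b u => by simp [Fin.sum_univ_three, rowForm]; ring)
    (fun r a u => by simp [Fin.sum_univ_three, rowForm, smul_eq_C_mul]; ring)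
    (fun a u v => by simp [Fin.sum_univ_three, rowForm]; ring)
    (fun r a u => by simp [Fin.sum_univ_three, rowForm, smul_eq_C_mul]; ring)

lemma crossForm_apply (a u : Fin 3 → R) :
    crossForm R a u = - ∑ p, C (u p) * rowForm a p := rfl

lemma crossForm_self (a : Fin 3 → R) : crossForm R a a = 0 := by
  simp [crossForm_apply, Fin.sum_univ_three, rowForm]
  ring

lemma crossForm_swap (a u : Fin 3 → R) : crossForm R u a = - crossForm R a u := by
  simp [crossForm_apply, Fin.sum_univ_three, rowForm]
  ring

lemma crossForm_single (p : Fin 3) :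
    crossForm R (Pi.single (p + 1) 1) (Pi.single (p + 2) 1) = X p := by
  fin_cases p <;> simp [crossForm_apply, rowForm, Pi.single_apply]

lemma crossForm_mem {L : List (Fin 3 → R)} {a : Fin 3 → R}
    (ha : a ∈ Submodule.span R {a | a ∈ L}) (u : Fin 3 → R) : crossForm R a u ∈ rowIdeal L := by
  induction ha using Submodule.span_induction with
  | mem a ha =>
    exact neg_mem (sum_mem fun p _ => Ideal.mul_mem_left _ _ (rowForm_mem ha p))
  | zero => simp
  | add a b _ _ ha hb => simpa using add_mem ha hb
  | smul r a _ ha =>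
    rw [map_smul, LinearMap.smul_apply, smul_eq_C_mul]
    exact Ideal.mul_mem_left _ _ ha

variable {L : List (Fin 3 → R)} {K : Submodule R (Fin 3 → R)}

/-- The alternating form on the cokernel induced by `crossForm`. -/
def cokerForm (hK : K = Submodule.span R {a | a ∈ L}) :
    ((Fin 3 → R) ⧸ K) →ₗ[R] ((Fin 3 → R) ⧸ K) →ₗ[R] (MvPolynomial (Fin 3) R ⧸ rowIdeal L) :=
  have h0 : ∀ a ∈ K, ∀ u, Ideal.Quotient.mkₐ R (rowIdeal L) (crossForm R a u) = 0 :=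
    fun a ha u => Ideal.Quotient.eq_zero_iff_mem.2 (crossForm_mem (hK ▸ ha) u)
  K.liftQ (K.liftQ ((crossForm R).compr₂ (Ideal.Quotient.mkₐ R (rowIdeal L)).toLinearMap)
    (fun a ha => LinearMap.ext (h0 a ha))).flip fun a ha => LinearMap.ext fun x => by
      obtain ⟨u, rfl⟩ := K.mkQ_surjective x
      change Ideal.Quotient.mkₐ R (rowIdeal L) (crossForm R u a) = 0
      rw [crossForm_swap, map_neg, h0 a ha, neg_zero]

lemma cokerForm_mk (hK : K = Submodule.span R {a | a ∈ L}) (a u : Fin 3 → R) :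
    cokerForm hK (K.mkQ a) (K.mkQ u) = Ideal.Quotient.mkₐ R (rowIdeal L) (crossForm R u a) := rfl

/-- The generators of the second exterior power of a cokernel. -/
def cokerWedge (K : Submodule R (Fin 3 → R)) (p : Fin 3) : ⋀[R]^2 ((Fin 3 → R) ⧸ K) :=
  wedge (K.mkQ (Pi.single (p + 1) 1)) (K.mkQ (Pi.single (p + 2) 1))

lemma span_cokerWedge (K : Submodule R (Fin 3 → R)) :
    Submodule.span R (Set.range (cokerWedge K)) = ⊤ := by
  rw [eq_top_iff, ← span_wedge, Submodule.span_le]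
  rintro _ ⟨x, y, rfl⟩
  have hx : ∀ x : (Fin 3 → R) ⧸ K, ∃ u : Fin 3 → R,
      x = ∑ p, u p • K.mkQ (Pi.single p 1) := fun x => by
    obtain ⟨u, rfl⟩ := K.mkQ_surjective x
    refine ⟨u, ?_⟩
    simp_rw [← map_smul, ← map_sum]
    congr 1
    exact pi_eq_sum_univ' u
  obtain ⟨u, hu⟩ := hx x
  obtain ⟨w, hw⟩ := hx y
  have hb : ∀ p, cokerWedge K p ∈ Submodule.span R (Set.range (cokerWedge K)) :=
    fun p => Submodule.subset_span ⟨p, rfl⟩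
  have e : wedge (R := R) x y = ∑ p, (u (p + 1) * w (p + 2) - u (p + 2) * w (p + 1)) •
      cokerWedge K p := by
    rw [hu, hw]
    simp only [Fin.sum_univ_three, wedge_add_left, wedge_add_right, wedge_smul_left,
      wedge_smul_right, wedge_self, cokerWedge]
    rw [wedge_neg_swap (K.mkQ (Pi.single 1 1)) (K.mkQ (Pi.single 0 1)),
      wedge_neg_swap (K.mkQ (Pi.single 2 1)) (K.mkQ (Pi.single 1 1)),
      wedge_neg_swap (K.mkQ (Pi.single 0 1)) (K.mkQ (Pi.single 2 1))]
    simp only [Fin.isValue, zero_add, Fin.reduceAdd]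
    module
  rw [e]
  exact sum_mem fun p _ => Submodule.smul_mem _ _ (hb p)

lemma cokerWedge_rel {a : Fin 3 → R} (ha : a ∈ K) (p : Fin 3) :
    a (p + 1) • cokerWedge K (p + 2) = a (p + 2) • cokerWedge K (p + 1) := by
  have h : K.mkQ a = 0 := by simpa using ha
  have h2 : a = a p • Pi.single p 1 + a (p + 1) • Pi.single (p + 1) 1 +
      a (p + 2) • Pi.single (p + 2) 1 := by
    ext q
    fin_cases p <;> fin_cases q <;> simp
  rw [h2, map_add, map_add, map_smul, map_smul, map_smul] at h
  have h3 : wedge (R := R) (K.mkQ (Pi.single p 1)) (0 : (Fin 3 → R) ⧸ K) = 0 := by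
    simpa using wedge_smul_right (0 : R) (K.mkQ (Pi.single p 1)) 0
  rw [← h] at h3
  simp only [wedge_add_right, wedge_smul_right, wedge_self] at h3
  have e1 : p + 2 + 1 = p := by fin_cases p <;> rfl
  have e2 : p + 2 + 2 = p + 1 := by fin_cases p <;> rfl
  have e3 : p + 1 + 1 = p + 2 := by fin_cases p <;> rfl
  have e4 : p + 1 + 2 = p := by fin_cases p <;> rfl
  rw [cokerWedge, cokerWedge, e1, e2, e3, e4,
    wedge_neg_swap (K.mkQ (Pi.single (p + 2) 1)), smul_neg]
  rw [smul_zero, zero_add] at h3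
  exact eq_neg_of_add_eq_zero_left h3

/-- The kernel of the presentation of `S₂ (⋀² M)` by quadratic forms. -/
lemma polySym_cokerWedge_eq_zero_iff (hK : K = Submodule.span R {a | a ∈ L})
    {P : MvPolynomial (Fin 3) R} (hP : P.IsHomogeneous 2) :
    polySym (cokerWedge K) P = 0 ↔ P ∈ rowIdeal L := by
  refine ⟨fun h => ?_, fun h => polySym_eq_zero _ (fun a ha p => cokerWedge_rel ?_ p) h⟩
  · have hb : ∀ x, cokerForm hK x x = 0 := fun x => by
      obtain ⟨u, rfl⟩ := K.mkQ_surjective x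
      rw [cokerForm_mk, crossForm_self, map_zero]
    have := symLift_polySym (cokerWedge K) (-wedgeLift (cokerForm hK) hb)
      (Ideal.Quotient.mkₐ R (rowIdeal L)) (fun p => by
        rw [LinearMap.neg_apply, cokerWedge, wedgeLift_wedge, cokerForm_mk, crossForm_swap, map_neg,
          neg_neg, crossForm_single]) hP
    rw [h, map_zero] at this
    exact Ideal.Quotient.eq_zero_iff_mem.1 this.symm
  · rw [hK]
    exact Submodule.subset_span ha

end Cokernel

lemma nonempty_equiv_of_surjective {R P N N' : Type} [CommRing R] [AddCommGroup P] [Module R P]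
    [AddCommGroup N] [Module R N] [AddCommGroup N'] [Module R N'] (f : P →ₗ[R] N)
    (g : P →ₗ[R] N') (hf : Function.Surjective f) (hg : Function.Surjective g)
    (h : ∀ x, f x = 0 ↔ g x = 0) : Nonempty (N ≃ₗ[R] N') := by
  have hk : LinearMap.ker f = LinearMap.ker g := Submodule.ext h
  exact ⟨(f.quotKerEquivOfSurjective hf).symm ≪≫ₗ Submodule.quotEquivOfEq _ _ hk ≪≫ₗ
    g.quotKerEquivOfSurjective hg⟩

section Comparison

open MvPolynomial

variable {R V : Type} [CommRing R] [AddCommGroup V] [Module R V] {X : StrandData R V} {t : ℤ}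

/-- The functionals on a graded piece that factor through the differential. -/
def StrandData.coboundaries (X : StrandData R V) (i δ : ℤ) :
    Submodule R (X.gr i δ →ₗ[R] R) :=
  LinearMap.range (LinearMap.lcomp R R (X.D ∘ₗ (X.gr i δ).subtype))

lemma StrandData.mem_coboundaries {i δ : ℤ} {φ : X.gr i δ →ₗ[R] R} :
    φ ∈ X.coboundaries i δ ↔ ∃ ψ : V →ₗ[R] R, ∀ v, φ v = ψ (X.D (v : V)) :=
  ⟨fun ⟨ψ, h⟩ => ⟨ψ, fun v => by rw [← h]; rfl⟩,
    fun ⟨ψ, h⟩ => ⟨ψ, LinearMap.ext fun v => (h v).symm⟩⟩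

/-- The top cohomology of the dual of the strand is the second symmetric power of `⋀² M`. -/
lemma StrandData.Good.nonempty_equiv_symPow {L : List (Fin 3 → R)} (hX : X.Good t) {m : ℤ}
    (hL : ∀ a ∈ L, ∀ p, X.NullHtpy (crossOp a X.y p)) (hT : X.Top t m L)
    {K : Submodule R (Fin 3 → R)} (hK : K = Submodule.span R {a | a ∈ L}) {i : ℤ} (hi : i = t)
    (hm : m - 2 = 3) :
    Nonempty (((X.gr i 3 →ₗ[R] R) ⧸ X.coboundaries i 3) ≃ₗ[R]
      SymPow R (⋀[R]^2 ((Fin 3 → R) ⧸ K)) 2) := by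
  subst hi
  have hm' : m - ((2 : ℕ) : ℤ) = 3 := hm
  refine nonempty_equiv_of_surjective (P := homogeneousSubmodule (Fin 3) R 2)
    ((X.coboundaries i 3).mkQ ∘ₗ LinearMap.lcomp R R (X.gr i 3).subtype ∘ₗ X.Ψ ∘ₗ
      (homogeneousSubmodule (Fin 3) R 2).subtype)
    (polySym (cokerWedge K) ∘ₗ (homogeneousSubmodule (Fin 3) R 2).subtype) (fun z => ?_)
    (fun z => ?_) (fun P => ?_)
  · obtain ⟨φ, rfl⟩ := Submodule.mkQ_surjective _ z
    obtain ⟨ι, _, f, e, he, h⟩ := hX.dualBasis i 3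
    obtain ⟨P, hP, ψ, hψ⟩ := hT.surj 2 (∑ j, φ ⟨e j, he j⟩ • f j)
    rw [hm'] at hψ
    refine ⟨⟨P, hP⟩, ?_⟩
    refine ((Submodule.Quotient.eq _).2 (mem_coboundaries.2 ⟨ψ, fun v => ?_⟩) :
      Submodule.Quotient.mk φ = _).symm
    have h1 : φ v = ∑ j, φ ⟨e j, he j⟩ * f j v := by
      have hv : v = ∑ j, f j v • (⟨e j, he j⟩ : X.gr i 3) := by
        ext
        simpa using h v v.2
      refine (congr_arg φ hv).trans ((map_sum _ _ _).trans ?_)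
      refine Finset.sum_congr rfl fun j _ => ?_
      rw [map_smul, smul_eq_mul, mul_comm]
    have h2 := hψ v v.2
    simp only [LinearMap.sum_apply, LinearMap.smul_apply, smul_eq_mul] at h2
    rw [LinearMap.sub_apply, h1, h2]
    exact add_sub_cancel_left _ _
  · obtain ⟨P, hP, rfl⟩ := exists_polySym_eq (cokerWedge K) (span_cokerWedge K) z
    exact ⟨⟨P, hP⟩, rfl⟩
  · refine Iff.trans ?_ (polySym_cokerWedge_eq_zero_iff hK P.2).symm
    refine (Submodule.Quotient.mk_eq_zero _).trans (mem_coboundaries.trans ⟨?_, fun h => ?_⟩)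
    · rintro ⟨ψ, hψ⟩
      refine hT.mem 2 (by norm_num) P P.2 ψ fun v hv => ?_
      rw [hm'] at hv
      exact hψ ⟨v, hv⟩
    · obtain ⟨ψ, hψ⟩ := hX.exists_coboundary hL h 3
      exact ⟨ψ, fun v => hψ v v.2⟩

end Comparison

lemma range_phiStar {k : Type} [Field k] {n g : ℕ} (A : Matrix (Fin g) (Fin 3) (RR k n)) :
    LinearMap.range (phiStar A) =
      Submodule.span (RR k n) {a | a ∈ List.ofFn fun i => A i} := by
  rw [phiStar, Matrix.range_mulVecLin]
  congr 1
  ext a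
  exact (List.mem_ofFn (f := fun i => A i)).symm

lemma minors_ne_top {k : Type} [Field k] {n g : ℕ} {A : Matrix (Fin g) (Fin 3) (RR k n)}
    (hA : IsMinMatrix A) : minors A 2 ≠ ⊤ := by
  have : minors A 2 ≤ RingHom.ker (MvPolynomial.constantCoeff (R := k) (σ := Fin (n + 1))) := by
    rw [minors_two_eq_span, Ideal.span_le]
    rintro _ ⟨i, j, p, rfl⟩
    have h : ∀ i j, MvPolynomial.constantCoeff (A i j) = 0 := hA
    simp [RingHom.mem_ker, h]
  intro h
  rw [h, top_le_iff] at this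
  exact RingHom.ker_ne_top _ this

section Main

variable {R : Type} [CommRing R] [IsNoetherianRing R]

/-- `S₂ (⋀² M)` is the top `Ext` of the ideal of `2 × 2` minors of a `5 × 3` matrix, if that ideal
has the maximal depth. -/
theorem nonempty_ext_iso_symPow (a : Fin 5 → Fin 3 → R) {I : Ideal R}
    (hI : I = Ideal.span
      {m | ∃ i j p, m = a i (p + 1) * a j (p + 2) - a i (p + 2) * a j (p + 1)})
    (hext : ExtVanishing I 8 R) {K : Submodule R (Fin 3 → R)}
    (hK : K = Submodule.span R {v | v ∈ List.ofFn a}) :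
    Nonempty (ExtM R 8 (R ⧸ I) R ≅
      ModuleCat.of R (SymPow R (⋀[R]^2 ((Fin 3 → R) ⧸ K)) 2)) := by
  obtain ⟨V, _, _, X, hX, hL, hIm, hT⟩ := StrandData.exists_of_rows (I := I)
    (S := Set.range a) (by
      rintro _ ⟨i, rfl⟩ _ ⟨j, rfl⟩ p
      rw [hI]
      exact Ideal.subset_span ⟨i, j, p, rfl⟩) (List.ofFn a) (by
      intro v hv
      obtain ⟨i, rfl⟩ := List.mem_ofFn.1 hv
      exact ⟨i, rfl⟩)
  have hmemL : ∀ i, a i ∈ List.ofFn a := fun i => List.mem_ofFn.2 ⟨i, rfl⟩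
  have hlenL : ((List.ofFn a).length : ℤ) = 5 := by simp
  have hH : ∀ r ∈ {m | ∃ i j p, m = a i (p + 1) * a j (p + 2) - a i (p + 2) * a j (p + 1)},
      ∀ m, X.NullHtpy (r • X.y m) := by
    rintro _ ⟨i, j, p, rfl⟩ m
    exact StrandData.nullHtpy_minor (hL _ (hmemL i)) (hL _ (hmemL j)) p m
  have hE : LinearMap.range (StrandData.strandD hX 0) = I := by
    refine le_antisymm ?_ ?_
    · rintro _ ⟨v, rfl⟩
      exact hIm.sub3 v.1 v.2
    · rw [hI]
      refine Submodule.span_le.2 ?_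
      rintro _ ⟨i, j, p, rfl⟩
      obtain ⟨z, hz, h⟩ := hIm.sup3 _ (hmemL i) _ (hmemL j) p
      exact ⟨⟨z, hz⟩, h⟩
  obtain ⟨e⟩ := hX.nonempty_ext_iso (c := 6) (by rw [hlenL]; norm_num) hI hext
    hH hE (X.coboundaries _ 3).mkQ (Submodule.mkQ_surjective _) fun φ =>
      (Submodule.Quotient.mk_eq_zero _).trans StrandData.mem_coboundaries
  obtain ⟨e'⟩ := hX.nonempty_equiv_symPow hL hT hK
    (i := (((6 + 1 : ℕ) : ℤ) + 3)) (by rw [hlenL]; norm_num) (by rw [hlenL]; norm_num)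
  exact ⟨e ≪≫ e'.toModuleIso⟩

end Main

theorem nonempty_symPow_iso_ext {k : Type} [Field k] {n : ℕ} {A : Matrix (Fin 5) (Fin 3) (RR k n)}
    (hA : IsMinMatrix A) (hdepth : depthGE (minors A 2) (RR k n) 8) :
    misoM (ModuleCat.of _ (SymPow (RR k n) (⋀[RR k n]^2 (Mdl A)) 2))
      (ExtM (RR k n) 8 (RR k n ⧸ minors A 2) (RR k n)) := by
  obtain ⟨rs, hlen, hmem, hreg⟩ := hdepth
  have hext : ExtVanishing (minors A 2) 8 (RR k n) :=
    hlen ▸ extVanishing_of_isRegular (minors_ne_top hA) rs hmem hreg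
  obtain ⟨e⟩ := nonempty_ext_iso_symPow A (minors_two_eq_span A) hext (range_phiStar A)
  exact ⟨e.symm⟩

/-- Remark 3.11(3); t = 3, c = 3.
For a graded minimal morphism `φ : F → G` of free modules of ranks `3` and `5` with
`depth_{I₂(φ)} R = 8`, one has `S₂(⋀²M) ≅ K_{B₂}(n+1-2ℓ)`; as ungraded `R`-modules,
`S₂(⋀²M) ≅ Ext_R^8(B₂, R)` where `B₂ = R/I₂(φ)`. -/
theorem statement_5 {k : Type} [Field k] [IsAlgClosed k] [CharZero k]
    {n : ℕ}
    (A : Matrix (Fin 5) (Fin 3) (RR k n))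
    (a : Fin 5 → ℤ) (b : Fin 3 → ℤ)
    (hhom : IsHomogMatrix A a b) (hmin : IsMinMatrix A)
    (hdepth : depthEQ (minors A 2) (RR k n) 8) :
    misoM
      (ModuleCat.of (RR k n) (SymPow (RR k n) (⋀[RR k n]^2 (Mdl A)) 2))
      (ExtM (RR k n) 8 (RR k n ⧸ minors A 2) (RR k n)) := by
  exact nonempty_symPow_iso_ext hmin hdepth.1

end KMR
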